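/- Under conditions (A1)–(A3): (i) T_n(φ1) = k^{−1/2} max_{1≤l≤n} | Σ_{i=1}^l 1{X_i > b(n/k)} − (l/n) Σ_{i=1}^n 1{X_i > b(n/k)} | + o_P(1); and (ii) if additionally (k ∨ r_n³) e^{−ε√k/r_n} = o(1) for every ε > 0, then T_n(φ2) = k^{−1/2} max_{1≤l≤n} | Σ_{i=1}^l (log X_i − log b(n/k))_+ − (l/n) Σ_{i=1}^n (log X_i − log b(n/k))_+ | + o_P(1). In other words, replacing the random threshold X_{(k)} by the deterministic quantile b(n/k) changes the cusum statistics only by terms converging to 0 in probability. -/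

import Mathlib

open MeasureTheory ProbabilityTheory Filter Set
open scoped ProbabilityTheory

noncomputable section

namespace TailCusum

variable {Ω : Type*} [MeasureSpace Ω]

/-- `φ₁(x) = 1{x > 0}`. -/
def phi1 (x : ℝ) : ℝ := if 0 < x then 1 else 0

/-- `φ₂(x) = x₊ = max {x, 0}`. -/
def phi2 (x : ℝ) : ℝ := max x 0

/-- positive part -/
def pos (x : ℝ) : ℝ := max x 0

/-- A positive measurable function `g` is regularly varying at `∞` with index `ρ` if
`g(λ x)/g(x) → λ^ρ` as `x → ∞` for every `λ > 0`. -/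
def RegularlyVarying (g : ℝ → ℝ) (ρ : ℝ) : Prop :=
  Measurable g ∧ ∀ lam : ℝ, 0 < lam →
    Tendsto (fun x => g (lam * x) / g x) atTop (nhds (lam ^ ρ))

/-- `l` is slowly varying at `∞`. -/
def SlowlyVarying (l : ℝ → ℝ) : Prop :=
  Measurable l ∧ ∀ lam : ℝ, 0 < lam →
    Tendsto (fun x => l (lam * x) / l x) atTop (nhds 1)

/-- `κ(λ) = K ∫_1^λ t^(γ-1) dt`. -/
def kappaFun (K γ : ℝ) (lam : ℝ) : ℝ := K * ∫ t in (1:ℝ)..lam, t ^ (γ - 1)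

/-- Second-order regular variation condition on the slowly varying function `l`
(the core of condition (A2)): `(l(λx)/l(x) - 1)/g(x) → κ(λ)` with
`κ(λ) = K ∫_1^λ t^(γ-1) dt`, `g` positive and regularly varying with index `γ ≤ 0`. -/
def SecondOrderRV (l g : ℝ → ℝ) (K γ : ℝ) : Prop :=
  γ ≤ 0 ∧ (∀ x, 0 < g x) ∧ RegularlyVarying g γ ∧
  ∀ lam : ℝ, 0 < lam →
    Tendsto (fun x => (l (lam * x) / l x - 1) / g x) atTop (nhds (kappaFun K γ lam))

/-- distribution function of a law on `ℝ` -/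
def df (μ : Measure ℝ) (x : ℝ) : ℝ := (μ (Iic x)).toReal

/-- tail distribution function `F̄(x) = μ(x, ∞)` -/
def tailDF (μ : Measure ℝ) (x : ℝ) : ℝ := (μ (Ioi x)).toReal

/-- the quantile-type function `b(x) = inf {y : F(y) ≥ 1 - x⁻¹}` -/
def quantileB (μ : Measure ℝ) (x : ℝ) : ℝ := sInf {y : ℝ | 1 - x⁻¹ ≤ df μ y}

/-- `F̄(x) = x^(-α) l(x)` for `x > 0` with `l` slowly varying: Pareto-type tail. -/
def ParetoTail (μ : Measure ℝ) (α : ℝ) (l : ℝ → ℝ) : Prop :=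
  SlowlyVarying l ∧ ∀ x : ℝ, 0 < x → tailDF μ x = x ^ (-α) * l x

/-- strict stationarity of a sequence of random variables -/
def IsStationary (X : ℕ → Ω → ℝ) : Prop :=
  ∀ j : ℕ,
    Measure.map (fun ω => fun i : ℕ => X (i + j) ω) (ℙ : Measure Ω)
      = Measure.map (fun ω => fun i : ℕ => X i ω) (ℙ : Measure Ω)

/-- strict stationarity, `ℤ`-indexed -/
def IsStationaryZ (X : ℤ → Ω → ℝ) : Prop :=
  ∀ j : ℤ,
    Measure.map (fun ω => fun i : ℤ => X (i + j) ω) (ℙ : Measure Ω)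
      = Measure.map (fun ω => fun i : ℤ => X i ω) (ℙ : Measure Ω)

/-- The β-mixing coefficient of the sequence `X` at lag `lag`, expressed as
the supremum over `m` of the total-variation distance between the joint law of
`(X_1, …, X_m)` and `(X_{m+lag+1}, X_{m+lag+2}, …)` and the product of the two laws. -/
def betaMix (X : ℕ → Ω → ℝ) (lag : ℕ) : ℝ :=
  ⨆ m : ℕ, ⨆ S : Subtype (MeasurableSet : Set ((Fin m → ℝ) × (ℕ → ℝ)) → Prop),
    |((Measure.map
        (fun ω => ((fun i : Fin m => X ((i : ℕ) + 1) ω, fun i : ℕ => X (m + lag + 1 + i) ω)))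
        (ℙ : Measure Ω)) S.1).toReal
      - (((Measure.map (fun ω => fun i : Fin m => X ((i : ℕ) + 1) ω) (ℙ : Measure Ω)).prod
          (Measure.map (fun ω => fun i : ℕ => X (m + lag + 1 + i) ω) (ℙ : Measure Ω))) S.1).toReal|

/-- The tail sample fraction condition: `k → ∞` and `k = o(n)`. -/
def TailFraction (k : ℕ → ℕ) : Prop :=
  Tendsto (fun n : ℕ => (k n : ℝ)) atTop atTop ∧
    Tendsto (fun n : ℕ => (k n : ℝ) / n) atTop (nhds 0)

/-- Condition (A1): `(n / r_n) β([ε r_n]) → 0` for every `ε > 0`, and `r_n² = o(k)`. -/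
def CondA1 (X : ℕ → Ω → ℝ) (k r : ℕ → ℕ) : Prop :=
  (∀ n, 0 < r n) ∧
  (∀ ε : ℝ, 0 < ε →
    Tendsto (fun n : ℕ => ((n : ℝ) / r n) * betaMix X ⌊ε * r n⌋₊) atTop (nhds 0)) ∧
  Tendsto (fun n : ℕ => ((r n : ℝ) ^ 2 / k n)) atTop (nhds 0)

/-- Condition (A2): second-order regular variation of `l` plus
`√k · g(b(n/k)) → A ∈ ℝ`. -/
def CondA2 (l g : ℝ → ℝ) (K γ A : ℝ) (b : ℝ → ℝ) (k : ℕ → ℕ) : Prop :=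
  SecondOrderRV l g K γ ∧
    Tendsto (fun n : ℕ => Real.sqrt (k n) * g (b ((n : ℝ) / k n))) atTop (nhds A)

/-- covariance of two real random variables -/
def cov (f g : Ω → ℝ) : ℝ :=
  ∫ ω, (f ω - ∫ ω', f ω') * (g ω - ∫ ω', g ω')

/-- pairs `1 ≤ i < j ≤ N` -/
def pairsUpTo (N : ℕ) : Finset (ℕ × ℕ) :=
  ((Finset.Icc 1 N) ×ˢ (Finset.Icc 1 N)).filter fun p => p.1 < p.2

/-- Condition (A3): existence of the limits `χ` and `ω` of the normalized sums of
covariances, for every `0 < ε < 1`. -/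
def CondA3 (X : ℕ → Ω → ℝ) (b : ℝ → ℝ) (k r : ℕ → ℕ) (α χ ωc : ℝ) : Prop :=
  0 ≤ χ ∧ 0 ≤ ωc ∧
  ∀ ε : ℝ, 0 < ε → ε < 1 →
    (Tendsto (fun n : ℕ =>
        (2 * α ^ 2 * n / ((⌊ε * r n⌋₊ : ℝ) * k n)) *
          ∑ p ∈ pairsUpTo ⌊ε * r n⌋₊,
            cov (fun ω => pos (Real.log (X p.1 ω) - Real.log (b ((n : ℝ) / k n))))
                (fun ω => pos (Real.log (X p.2 ω) - Real.log (b ((n : ℝ) / k n)))))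
      atTop (nhds χ)) ∧
    (Tendsto (fun n : ℕ =>
        (2 * (n : ℝ) / ((⌊ε * r n⌋₊ : ℝ) * k n)) *
          ∑ p ∈ pairsUpTo ⌊ε * r n⌋₊,
            cov (fun ω => if b ((n : ℝ) / k n) < X p.1 ω then (1 : ℝ) else 0)
                (fun ω => if b ((n : ℝ) / k n) < X p.2 ω then (1 : ℝ) else 0))
      atTop (nhds ωc))

/-- the `k`-th largest value among `X_1, …, X_n` -/
def orderStat (n k : ℕ) (X : ℕ → Ω → ℝ) (ω : Ω) : ℝ :=
  sInf {x : ℝ | ((Finset.Icc 1 n).filter fun i => x < X i ω).card < k}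

/-- `|Σ_{i=1}^l Y_i - (l/n) Σ_{i=1}^n Y_i|` -/
def cusumAt (n : ℕ) (Y : ℕ → ℝ) (l : ℕ) : ℝ :=
  |∑ i ∈ Finset.Icc 1 l, Y i - ((l : ℝ) / n) * ∑ i ∈ Finset.Icc 1 n, Y i|

/-- The cusum statistic `T_n(φ)` with random threshold `X_(k)`. -/
def cusum (n k : ℕ) (X : ℕ → Ω → ℝ) (φ : ℝ → ℝ) (ω : Ω) : ℝ :=
  (Real.sqrt k)⁻¹ *
    ⨆ l ∈ Finset.Icc 1 n,
      cusumAt n (fun i => φ (Real.log (X i ω) - Real.log (orderStat n k X ω))) l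

/-- The cusum statistic with deterministic threshold `b(n/k)`. -/
def cusumDet (n k : ℕ) (X : ℕ → Ω → ℝ) (φ : ℝ → ℝ) (b : ℝ → ℝ) (ω : Ω) : ℝ :=
  (Real.sqrt k)⁻¹ *
    ⨆ l ∈ Finset.Icc 1 n,
      cusumAt n (fun i => φ (Real.log (X i ω) - Real.log (b ((n : ℝ) / k)))) l

/-- convergence in distribution (weak convergence of laws) of real random variables to
a real random variable `Z` defined on a possibly different probability space -/
def TendstoInDist {Ω' : Type*} [MeasureSpace Ω'] (Y : ℕ → Ω → ℝ) (Z : Ω' → ℝ) : Prop :=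
  ∀ f : ℝ → ℝ, Continuous f → (∃ C, ∀ x, |f x| ≤ C) →
    Tendsto (fun n : ℕ => ∫ ω, f (Y n ω)) atTop (nhds (∫ ω, f (Z ω)))

/-- convergence in distribution to a law `μ` on `ℝ` -/
def TendstoInLaw (Y : ℕ → Ω → ℝ) (μ : Measure ℝ) : Prop :=
  ∀ f : ℝ → ℝ, Continuous f → (∃ C, ∀ x, |f x| ≤ C) →
    Tendsto (fun n : ℕ => ∫ ω, f (Y n ω)) atTop (nhds (∫ x, f x ∂μ))

/-- bounded in probability (`O_P(1)`) -/
def BddInProb (Y : ℕ → Ω → ℝ) : Prop :=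
  ∀ ε : ℝ, 0 < ε → ∃ C : ℝ, ∀ᶠ n in atTop,
    ((ℙ : Measure Ω) {ω | C < |Y n ω|}).toReal < ε

/-- divergence to `+∞` in probability -/
def DivergesInProb (Y : ℕ → Ω → ℝ) : Prop :=
  ∀ C : ℝ, Tendsto (fun n : ℕ => ((ℙ : Measure Ω) {ω | Y n ω ≤ C}).toReal) atTop (nhds 0)

/-- standard Brownian motion on `[0, ∞)` -/
structure IsStdBrownianMotion {Ω' : Type*} [MeasureSpace Ω'] (B : ℝ → Ω' → ℝ) : Prop where
  isProb : IsProbabilityMeasure (ℙ : Measure Ω')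
  meas : ∀ t, Measurable (B t)
  start : ∀ᵐ ω ∂(ℙ : Measure Ω'), B 0 ω = 0
  gauss_incr : ∀ s t : ℝ, 0 ≤ s → s ≤ t →
    Measure.map (fun ω => B t ω - B s ω) (ℙ : Measure Ω')
      = gaussianReal 0 (Real.toNNReal (t - s))
  indep_incr : ∀ (n : ℕ) (ts : ℕ → ℝ), (∀ i, 0 ≤ ts i) → Monotone ts →
    iIndepFun (m := fun _ => Real.measurableSpace)
      (fun i : Fin n => fun ω => B (ts ((i : ℕ) + 1)) ω - B (ts (i : ℕ)) ω)
      (ℙ : Measure Ω')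

/-- `sup_{0 ≤ t ≤ 1} |B°(t)|` where `B°(t) = B(t) - t B(1)` is the Brownian bridge
associated with the Brownian motion `B` -/
def supAbsBrownianBridge {Ω' : Type*} [MeasureSpace Ω'] (B : ℝ → Ω' → ℝ) (ω : Ω') : ℝ :=
  ⨆ t : Icc (0 : ℝ) 1, |B (t : ℝ) ω - (t : ℝ) * B 1 ω|

/-- `A_i(ζ) = φ(log X_i - log b(n/k) + ζ/√k)` -/
def An (X : ℕ → Ω → ℝ) (b : ℝ → ℝ) (φ : ℝ → ℝ) (n k : ℕ) (ζ : ℝ) (i : ℕ) (ω : Ω) : ℝ :=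
  φ (Real.log (X i ω) - Real.log (b ((n : ℝ) / k)) + ζ / Real.sqrt k)

/-- the tail sequential process `M_n(t, ζ) = k^{-1/2} Σ_{i=1}^{[nt]} (A_i(ζ) - E A_1(ζ))` -/
def Mn (X : ℕ → Ω → ℝ) (b : ℝ → ℝ) (φ : ℝ → ℝ) (n k : ℕ) (t ζ : ℝ) (ω : Ω) : ℝ :=
  (Real.sqrt k)⁻¹ * ∑ i ∈ Finset.Icc 1 ⌊(n : ℝ) * t⌋₊,
    (An X b φ n k ζ i ω - ∫ ω', An X b φ n k ζ 1 ω')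

/-- residual `ξ̂_i = X_i - Σ_{j=1}^p φ̂_j X_{i-j}` of an AR(p) fit -/
def residual (p : ℕ) (X : ℤ → Ω → ℝ) (φh : Ω → Fin p → ℝ) (i : ℕ) (ω : Ω) : ℝ :=
  X i ω - ∑ j : Fin p, φh ω j * X ((i : ℤ) - ((j : ℕ) + 1)) ω

/-- absolute residual `Ẑ_i = |ξ̂_i|` -/
def Zhat (p : ℕ) (X : ℤ → Ω → ℝ) (φh : Ω → Fin p → ℝ) (i : ℕ) (ω : Ω) : ℝ :=
  |residual p X φh i ω|

/-- stationarity of the restriction of `Y` to the segment of indices `[a, b]` -/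
def SegStationary (a b : ℕ) (Y : ℕ → Ω → ℝ) : Prop :=
  ∀ (m : ℕ) (s : Fin m → ℕ) (j : ℕ), (∀ q, a ≤ s q ∧ s q + j ≤ b) →
    Measure.map (fun ω => fun q : Fin m => Y (s q + j) ω) (ℙ : Measure Ω)
      = Measure.map (fun ω => fun q : Fin m => Y (s q) ω) (ℙ : Measure Ω)

/-- the row-wise mixing coefficient
`β_n(l) = sup_m sup {|P(A∩B) - P(A)P(B)| : A ∈ σ(Y_i : m+l+1 ≤ i ≤ n), B ∈ σ(Y_1,…,Y_m)}` -/
def betaMixRow (n : ℕ) (Y : ℕ → Ω → ℝ) (lag : ℕ) : ℝ :=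
  ⨆ m : ℕ, ⨆ As : Subtype (MeasurableSet : Set (Fin (n - (m + lag)) → ℝ) → Prop),
    ⨆ Bs : Subtype (MeasurableSet : Set (Fin m → ℝ) → Prop),
      |((ℙ : Measure Ω)
          (((fun ω => fun i : Fin (n - (m + lag)) => Y (m + lag + 1 + (i : ℕ)) ω) ⁻¹' As.1)
            ∩ ((fun ω => fun i : Fin m => Y ((i : ℕ) + 1) ω) ⁻¹' Bs.1))).toReal
        - ((ℙ : Measure Ω)
            ((fun ω => fun i : Fin (n - (m + lag)) => Y (m + lag + 1 + (i : ℕ)) ω) ⁻¹' As.1)).toReal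
          * ((ℙ : Measure Ω)
            ((fun ω => fun i : Fin m => Y ((i : ℕ) + 1) ω) ⁻¹' Bs.1)).toReal|

/-- Convergence in measure survives a vanishing translation of the argument. -/
lemma tendstoInMeasure_dist_translate {E : Type*} [PseudoMetricSpace E]
    {f : ℕ → ℝ → E} {φ : ℝ → E}
    (hf : ∀ n, StronglyMeasurable (f n)) (hlim : ∀ s, Tendsto (fun n => f n s) atTop (nhds (φ s)))
    {u : ℕ → ℝ} (hu : Tendsto u atTop (nhds 0)) :
    TendstoInMeasure (volume.restrict (Icc (0 : ℝ) 1))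
      (fun n s => dist (f n (s - u n)) (φ (s - u n))) atTop (fun _ => (0 : ℝ)) := by
  have h1 : TendstoInMeasure (volume.restrict (Icc (-1 : ℝ) 2)) f atTop φ :=
    tendstoInMeasure_of_tendsto_ae (fun n => (hf n).aestronglyMeasurable)
      (Eventually.of_forall hlim)
  rw [tendstoInMeasure_iff_dist] at h1 ⊢
  intro ε hε
  refine tendsto_of_tendsto_of_tendsto_of_le_of_le' tendsto_const_nhds (h1 ε hε)
    (Eventually.of_forall fun _ => zero_le) ?_
  have hu1 : ∀ᶠ n in atTop, |u n| < 1 := by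
    have := (tendsto_zero_iff_norm_tendsto_zero.1 hu).eventually (gt_mem_nhds one_pos)
    simpa using this
  filter_upwards [hu1] with n hn
  rw [abs_lt] at hn
  rw [Measure.restrict_apply' measurableSet_Icc, Measure.restrict_apply' measurableSet_Icc]
  rw [← measure_preimage_add_right (volume : Measure ℝ) (-u n)
    ({x | ε ≤ dist (f n x) (φ x)} ∩ Icc (-1) 2)]
  simp only [← sub_eq_add_neg]
  refine measure_mono ?_
  rintro s ⟨h, h0, h1⟩
  simp only [mem_ofPred_eq, Real.dist_eq, sub_zero, abs_of_nonneg dist_nonneg] at h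
  exact ⟨h, by linarith, by linarith⟩

lemma exists_subseq_point_tendsto {E : Type*} [PseudoMetricSpace E]
    {f : ℕ → ℝ → E} {φ : ℝ → E} (hφ : Continuous φ)
    (hf : ∀ n, StronglyMeasurable (f n)) (hlim : ∀ s, Tendsto (fun n => f n s) atTop (nhds (φ s)))
    {u : ℕ → ℝ} (hu : Tendsto u atTop (nhds 0)) :
    ∃ ms : ℕ → ℕ, StrictMono ms ∧
      ∃ s : ℝ, Tendsto (fun n => f (ms n) (s - u (ms n))) atTop (nhds (φ s)) := by
  obtain ⟨ms, hms, hae⟩ := (tendstoInMeasure_dist_translate hf hlim hu).exists_seq_tendsto_ae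
  refine ⟨ms, hms, ?_⟩
  have hne : (ae (volume.restrict (Icc (0 : ℝ) 1))).NeBot := by
    rw [ae_neBot]
    intro h
    have := congrArg (fun m : Measure ℝ => m univ) h
    simp at this
  obtain ⟨s, hs⟩ := hae.exists
  refine ⟨s, ?_⟩
  have h2 : Tendsto (fun n => φ (s - u (ms n))) atTop (nhds (φ s)) := by
    have : Tendsto (fun n => s - u (ms n)) atTop (nhds s) := by
      simpa using tendsto_const_nhds.sub (hu.comp hms.tendsto_atTop)
    exact (hφ.tendsto s).comp this
  exact h2.congr_dist (by simpa [dist_comm] using hs)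

lemma continuous_kappaFun_exp (K γ : ℝ) : Continuous fun s : ℝ => kappaFun K γ (Real.exp s) := by
  unfold kappaFun
  refine continuous_const.mul (continuous_iff_continuousAt.2 fun s => ?_)
  have hs := Real.exp_pos s
  have hsub : uIcc (1 : ℝ) (Real.exp s) ⊆ Ioi 0 := fun x hx =>
    lt_of_lt_of_le (lt_min one_pos hs) hx.1
  have hc : ContinuousOn (fun t : ℝ => t ^ (γ - 1)) (Ioi 0) := fun x hx =>
    (Real.continuousAt_rpow_const x _ (Or.inl (ne_of_gt hx))).continuousWithinAt
  have hd := intervalIntegral.integral_hasDerivAt_right (f := fun t : ℝ => t ^ (γ - 1))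
    (a := 1) (b := Real.exp s) ((hc.mono hsub).intervalIntegrable)
    (hc.stronglyMeasurableAtFilter isOpen_Ioi _ hs) (hc.continuousAt (Ioi_mem_nhds hs))
  exact hd.continuousAt.comp (f := Real.exp) Real.continuous_exp.continuousAt

lemma SlowlyVarying.eventually_ne {l : ℝ → ℝ} (hl : SlowlyVarying l) :
    ∀ᶠ x in atTop, l x ≠ 0 := by
  have h := (hl.2 1 one_pos).eventually_ne (one_ne_zero)
  filter_upwards [h] with x hx h0
  simp [h0] at hx

/-- The second-order condition holds locally uniformly at `λ = 1`. -/
lemma secondOrderRV_local {l g : ℝ → ℝ} {K γ : ℝ} (hl : SlowlyVarying l)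
    (h2 : SecondOrderRV l g K γ) {x u : ℕ → ℝ} (hx : Tendsto x atTop atTop)
    (hu : Tendsto u atTop (nhds 0)) :
    Tendsto (fun n => (l (Real.exp (u n) * x n) / l (x n) - 1) / g (x n)) atTop (nhds 0) := by
  refine tendsto_of_subseq_tendsto fun ns hns => ?_
  obtain ⟨-, hgpos, hg, hκ⟩ := h2
  have hx' := hx.comp hns
  have hu' := hu.comp hns
  have hy' : Tendsto (fun n => Real.exp (u (ns n)) * x (ns n)) atTop atTop := by
    refine Tendsto.pos_mul_atTop (C := 1) one_pos ?_ hx'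
    simpa [Function.comp_def] using (Real.continuous_exp.tendsto 0).comp hu'
  set y : ℕ → ℝ := fun n => Real.exp (u (ns n)) * x (ns n) with hy
  have hlm := hl.1
  have hgm := hg.1
  obtain ⟨ms, hms, s, hs⟩ := exists_subseq_point_tendsto (E := ℝ × ℝ × ℝ)
    (f := fun n s => ((l (Real.exp s * y n) / l (y n) - 1) / g (y n),
      g (Real.exp s * y n) / g (y n), l (Real.exp s * y n) / l (y n)))
    (φ := fun s => (kappaFun K γ (Real.exp s), Real.exp s ^ γ, 1))
    (by
      refine (continuous_kappaFun_exp K γ).prodMk (Continuous.prodMk ?_ continuous_const)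
      exact Real.continuous_exp.rpow_const fun s => Or.inl (Real.exp_pos s).ne')
    (fun n => by
      refine Measurable.stronglyMeasurable ?_
      have h1 : Measurable fun s => l (Real.exp s * y n) :=
        hlm.comp (Real.measurable_exp.mul_const _)
      have h2 : Measurable fun s => g (Real.exp s * y n) :=
        hgm.comp (Real.measurable_exp.mul_const _)
      fun_prop)
    (fun s => by
      refine Tendsto.prodMk_nhds ?_ (Tendsto.prodMk_nhds ?_ ?_)
      · exact (hκ _ (Real.exp_pos s)).comp hy'
      · exact (hg.2 _ (Real.exp_pos s)).comp hy'
      · exact (hl.2 _ (Real.exp_pos s)).comp hy')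
    hu'
  refine ⟨ms, ?_⟩
  have hmt := hms.tendsto_atTop
  have hb := (continuous_fst.tendsto _).comp hs
  have hG := ((continuous_fst.comp continuous_snd).tendsto _).comp hs
  have hL := ((continuous_snd.comp continuous_snd).tendsto _).comp hs
  have ha := ((hκ _ (Real.exp_pos s)).comp hx').comp hmt
  have hGx := ((hg.2 _ (Real.exp_pos s)).comp hx').comp hmt
  have key := (ha.sub ((hGx.div hG (Real.rpow_pos_of_pos (Real.exp_pos s) γ).ne').mul hb)).div hL
    one_ne_zero
  have hval : (kappaFun K γ (Real.exp s)
      - Real.exp s ^ γ / Real.exp s ^ γ * kappaFun K γ (Real.exp s)) / 1 = 0 := by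
    rw [div_self (Real.rpow_pos_of_pos (Real.exp_pos s) γ).ne']; ring
  refine Tendsto.congr' ?_ (by simpa [hval] using key)
  have hlx := (hx'.comp hmt).eventually hl.eventually_ne
  have hly := (hy'.comp hmt).eventually hl.eventually_ne
  have hL0 := hL.eventually_ne one_ne_zero
  filter_upwards [hlx, hly, hL0] with n h1 h2 h3
  simp only [Function.comp_apply, hy, Pi.div_apply] at h1 h2 h3 ⊢
  have hE : Real.exp (s - u (ns (ms n))) * (Real.exp (u (ns (ms n))) * x (ns (ms n)))
      = Real.exp s * x (ns (ms n)) := by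
    rw [← mul_assoc, ← Real.exp_add]; simp
  rw [hE] at h3 ⊢
  have h4 : l (Real.exp s * x (ns (ms n))) ≠ 0 := fun h => h3 (by simp [h])
  have g1 := (hgpos (x (ns (ms n)))).ne'
  have g2 := (hgpos (Real.exp (u (ns (ms n))) * x (ns (ms n)))).ne'
  have g3 := (hgpos (Real.exp s * x (ns (ms n)))).ne'
  generalize l (Real.exp s * x (ns (ms n))) = c₁ at *
  generalize l (Real.exp (u (ns (ms n))) * x (ns (ms n))) = c₂ at *
  generalize g (Real.exp s * x (ns (ms n))) = c₃ at *
  generalize g (Real.exp (u (ns (ms n))) * x (ns (ms n))) = c₄ at *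
  field_simp
  ring

lemma df_eq_cdf (ν : Measure ℝ) [IsProbabilityMeasure ν] (x : ℝ) : df ν x = cdf ν x := by
  rw [cdf_eq_real]; rfl

lemma tailDF_eq (ν : Measure ℝ) [IsProbabilityMeasure ν] (x : ℝ) : tailDF ν x = 1 - cdf ν x := by
  have h := prob_compl_eq_one_sub (μ := ν) (measurableSet_Iic (a := x))
  rw [compl_Iic] at h
  rw [cdf_eq_real, tailDF, h, ENNReal.toReal_sub_of_le prob_le_one ENNReal.one_ne_top]
  rfl

lemma tailDF_antitone (ν : Measure ℝ) [IsProbabilityMeasure ν] : Antitone (tailDF ν) :=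
  fun x y h => by
    rw [tailDF_eq, tailDF_eq]
    linarith [monotone_cdf ν h]

lemma tailDF_nonneg (ν : Measure ℝ) (x : ℝ) : 0 ≤ tailDF ν x := ENNReal.toReal_nonneg

lemma ParetoTail.tailDF_pos {ν : Measure ℝ} [IsProbabilityMeasure ν] {α : ℝ} {l : ℝ → ℝ}
    (hF : ParetoTail ν α l) (x : ℝ) : 0 < tailDF ν x := by
  obtain ⟨y, ⟨h1, h2⟩, h3⟩ := ((hF.1.eventually_ne.and (eventually_gt_atTop 0)).and
    (eventually_ge_atTop x)).exists
  refine lt_of_lt_of_le (lt_of_le_of_ne (tailDF_nonneg ν y) (Ne.symm ?_)) (tailDF_antitone ν h3)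
  rw [hF.2 y h2]
  exact mul_ne_zero (Real.rpow_pos_of_pos h2 _).ne' h1

lemma quantileB_nonempty (ν : Measure ℝ) [IsProbabilityMeasure ν] {x : ℝ} (hx : 1 < x) :
    {y : ℝ | 1 - x⁻¹ ≤ df ν y}.Nonempty := by
  have h : 1 - x⁻¹ < 1 := by have := inv_pos.2 (one_pos.trans hx); linarith
  obtain ⟨y, hy⟩ := ((tendsto_cdf_atTop ν).eventually (lt_mem_nhds h)).exists
  exact ⟨y, by rw [mem_ofPred_eq, df_eq_cdf]; exact hy.le⟩

lemma quantileB_bddBelow (ν : Measure ℝ) [IsProbabilityMeasure ν] {x : ℝ} (hx : 1 < x) :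
    BddBelow {y : ℝ | 1 - x⁻¹ ≤ df ν y} := by
  have h : 0 < 1 - x⁻¹ := by have := inv_lt_one_of_one_lt₀ hx; linarith
  obtain ⟨M, hM⟩ := ((tendsto_cdf_atBot ν).eventually (gt_mem_nhds h)).exists
  refine ⟨M, fun y hy => ?_⟩
  rw [mem_ofPred_eq, df_eq_cdf] at hy
  by_contra! hlt
  linarith [monotone_cdf ν hlt.le]

lemma tailDF_quantileB_le (ν : Measure ℝ) [IsProbabilityMeasure ν] {x : ℝ} (hx : 1 < x) :
    tailDF ν (quantileB ν x) ≤ x⁻¹ := by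
  have hlim : Tendsto (cdf ν) (nhdsWithin (quantileB ν x) (Ioi (quantileB ν x)))
      (nhds (cdf ν (quantileB ν x))) :=
    ((cdf ν).right_continuous (quantileB ν x)).mono Ioi_subset_Ici_self
  have : 1 - x⁻¹ ≤ cdf ν (quantileB ν x) := by
    refine ge_of_tendsto hlim ?_
    filter_upwards [self_mem_nhdsWithin] with y hy
    obtain ⟨z, hz, hzy⟩ := exists_lt_of_csInf_lt (quantileB_nonempty ν hx) hy
    rw [mem_ofPred_eq, df_eq_cdf] at hz
    exact hz.trans (monotone_cdf ν hzy.le)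
  rw [tailDF_eq]; linarith

lemma inv_lt_tailDF_of_lt_quantileB (ν : Measure ℝ) [IsProbabilityMeasure ν] {x y : ℝ}
    (hx : 1 < x) (hy : y < quantileB ν x) : x⁻¹ < tailDF ν y := by
  have := notMem_of_lt_csInf hy (quantileB_bddBelow ν hx)
  rw [mem_ofPred_eq, df_eq_cdf, not_le] at this
  rw [tailDF_eq]; linarith

lemma TailFraction.eventually {k : ℕ → ℕ} (hk : TailFraction k) :
    ∀ᶠ n : ℕ in atTop, 0 < k n ∧ k n < n ∧ 1 < (n : ℝ) / k n := by
  filter_upwards [hk.1.eventually_gt_atTop 0, hk.2.eventually (gt_mem_nhds one_pos),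
    eventually_gt_atTop 0] with n h1 h2 h3
  have h3' : (0 : ℝ) < n := by exact_mod_cast h3
  rw [div_lt_one h3'] at h2
  exact ⟨by exact_mod_cast h1, by exact_mod_cast h2, by rwa [lt_div_iff₀ h1, one_mul]⟩

lemma tendsto_quantileB_atTop {ν : Measure ℝ} [IsProbabilityMeasure ν] {α : ℝ} {l : ℝ → ℝ}
    (hF : ParetoTail ν α l) {k : ℕ → ℕ} (hk : TailFraction k) :
    Tendsto (fun n : ℕ => quantileB ν ((n : ℝ) / k n)) atTop atTop := by
  refine tendsto_atTop.2 fun M => ?_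
  filter_upwards [hk.eventually, hk.2.eventually (gt_mem_nhds (hF.tailDF_pos M))] with n h1 h2
  by_contra! h
  have h3 := tailDF_quantileB_le ν h1.2.2
  rw [inv_div] at h3
  linarith [tailDF_antitone ν h.le]

lemma TailFraction.sqrt_atTop {k : ℕ → ℕ} (hk : TailFraction k) :
    Tendsto (fun n : ℕ => Real.sqrt (k n)) atTop atTop := by
  simpa [Function.comp_def] using Real.tendsto_sqrt_atTop.comp hk.1

lemma tendsto_mul_exp_div_sub_one {s : ℕ → ℝ} (hs : Tendsto s atTop atTop) (c : ℝ) :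
    Tendsto (fun n => s n * (Real.exp (c / s n) - 1)) atTop (nhds c) := by
  have h : HasDerivAt (fun t : ℝ => Real.exp (c * t)) c 0 := by
    have := (((hasDerivAt_id (0 : ℝ)).const_mul c).exp)
    simpa using this
  have h0 : Tendsto (fun n => (s n)⁻¹) atTop (nhdsWithin 0 {0}ᶜ) :=
    tendsto_nhdsWithin_iff.2 ⟨tendsto_inv_atTop_zero.comp hs, by
      filter_upwards [hs.eventually_gt_atTop 0] with n hn
      simpa using hn.ne'⟩
  refine (h.tendsto_slope.comp h0).congr fun n => ?_
  simp [slope_def_field, div_eq_mul_inv, mul_comm]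

/-- Ratio of tails at `e^{-c/√k} b(n/k)` and `b(n/k)`. -/
lemma tendsto_sqrt_mul_tail_ratio {ν : Measure ℝ} [IsProbabilityMeasure ν] {α : ℝ} {l : ℝ → ℝ}
    (hF : ParetoTail ν α l) {k : ℕ → ℕ} (hk : TailFraction k) {g : ℝ → ℝ} {K γ A : ℝ}
    (hA2 : CondA2 l g K γ A (quantileB ν) k) (c : ℝ) :
    Tendsto (fun n : ℕ => Real.sqrt (k n) *
      (tailDF ν (Real.exp (-(c / Real.sqrt (k n))) * quantileB ν ((n : ℝ) / k n))
        / tailDF ν (quantileB ν ((n : ℝ) / k n)) - 1)) atTop (nhds (α * c)) := by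
  have hb := tendsto_quantileB_atTop hF hk
  have hu : Tendsto (fun n => -(c / Real.sqrt (k n))) atTop (nhds 0) := by
    simpa using (hk.sqrt_atTop.const_div_atTop c).neg
  have hloc := secondOrderRV_local hF.1 hA2.1 hb hu
  have hE := tendsto_mul_exp_div_sub_one hk.sqrt_atTop (α * c)
  have hE1 : Tendsto (fun n => Real.exp (α * c / Real.sqrt (k n))) atTop (nhds 1) := by
    have := (Real.continuous_exp.tendsto 0).comp (hk.sqrt_atTop.const_div_atTop (α * c))
    simpa [Function.comp_def] using this
  have key := hE.add (hE1.mul (hA2.2.mul hloc))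
  rw [mul_zero, mul_zero, add_zero] at key
  refine key.congr' ?_
  filter_upwards [hb.eventually_gt_atTop 0, hb.eventually hF.1.eventually_ne] with n h1 h2
  have g0 := (hA2.1.2.1 (quantileB ν ((n : ℝ) / k n))).ne'
  rw [hF.2 _ h1, hF.2 _ (mul_pos (Real.exp_pos _) h1),
    Real.mul_rpow (Real.exp_pos _).le h1.le, ← Real.exp_mul]
  have hr := (Real.rpow_pos_of_pos h1 (-α)).ne'
  have he : -(c / Real.sqrt (k n)) * -α = α * c / Real.sqrt (k n) := by ring
  rw [he]
  generalize quantileB ν ((n : ℝ) / k n) ^ (-α) = w at *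
  generalize l (Real.exp (-(c / Real.sqrt (k n))) * quantileB ν ((n : ℝ) / k n)) = l1 at *
  field_simp
  ring

/-- Expected number of exceedances over `e^{-c/√k} b(n/k)`. -/
lemma tendsto_exceedance_mean {ν : Measure ℝ} [IsProbabilityMeasure ν] {α : ℝ} {l : ℝ → ℝ}
    (hF : ParetoTail ν α l) {k : ℕ → ℕ} (hk : TailFraction k) {g : ℝ → ℝ} {K γ A : ℝ}
    (hA2 : CondA2 l g K γ A (quantileB ν) k) (c : ℝ) :
    Tendsto (fun n : ℕ => (n *
      tailDF ν (Real.exp (-(c / Real.sqrt (k n))) * quantileB ν ((n : ℝ) / k n)) - k n)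
        / Real.sqrt (k n)) atTop (nhds (α * c)) := by
  have hb := tendsto_quantileB_atTop hF hk
  set w : ℕ → ℝ := fun n => n * tailDF ν (quantileB ν ((n : ℝ) / k n)) / k n with hw
  have hwle : ∀ᶠ n in atTop, w n ≤ 1 := by
    filter_upwards [hk.eventually] with n hn
    have h := tailDF_quantileB_le ν hn.2.2
    have hk0 : (0 : ℝ) < k n := by exact_mod_cast hn.1
    have hn0 : (0 : ℝ) < n := hk0.trans (by exact_mod_cast hn.2.1)
    rw [inv_div, le_div_iff₀ hn0] at h
    rw [hw, div_le_one hk0]; linarith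
  have hwlow : ∀ δ : ℝ, 0 < δ → ∀ᶠ n : ℕ in atTop, Real.sqrt (k n) * (1 - w n) ≤
      |Real.sqrt (k n) * (tailDF ν (Real.exp (-(δ / Real.sqrt (k n))) *
        quantileB ν ((n : ℝ) / k n)) / tailDF ν (quantileB ν ((n : ℝ) / k n)) - 1)| := by
    intro δ hδ
    filter_upwards [hk.eventually, hb.eventually_gt_atTop 0, hwle] with n hn hb0 hw1
    have hk0 : (0 : ℝ) < k n := by exact_mod_cast hn.1
    have hn0 : (0 : ℝ) < n := hk0.trans (by exact_mod_cast hn.2.1)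
    have hs : 0 < Real.sqrt (k n) := Real.sqrt_pos.2 hk0
    have hlt : Real.exp (-(δ / Real.sqrt (k n))) * quantileB ν ((n : ℝ) / k n)
        < quantileB ν ((n : ℝ) / k n) := by
      have : Real.exp (-(δ / Real.sqrt (k n))) < 1 := Real.exp_lt_one_iff.2 (by
        have := div_pos hδ hs; linarith)
      nlinarith
    have h := inv_lt_tailDF_of_lt_quantileB ν hn.2.2 hlt
    have hmono := tailDF_antitone ν hlt.le
    have hp := hF.tailDF_pos (quantileB ν ((n : ℝ) / k n))
    rw [inv_div, div_lt_iff₀ hn0] at h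
    have hw0 : 0 ≤ w n := by positivity
    refine le_trans ?_ (le_abs_self _)
    refine mul_le_mul_of_nonneg_left ?_ hs.le
    set T := tailDF ν (Real.exp (-(δ / Real.sqrt (k n))) * quantileB ν ((n : ℝ) / k n))
    set B := tailDF ν (quantileB ν ((n : ℝ) / k n)) with hB
    have h1 : 1 ≤ w n * (T / B) := by
      have : w n * (T / B) = T * n / k n := by
        rw [hw]; simp only [← hB]; field_simp
      rw [this, one_le_div hk0]; exact h.le
    have h2 : 1 ≤ T / B := (one_le_div hp).2 hmono
    nlinarith
  have hw0 : Tendsto (fun n => Real.sqrt (k n) * (1 - w n)) atTop (nhds 0) := by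
    rw [Metric.tendsto_atTop']
    intro ε hε
    have hδ : 0 < ε / (|α| + 1) := by positivity
    have h1 := (tendsto_sqrt_mul_tail_ratio hF hk hA2 (ε / (|α| + 1))).abs
    have h2 : |α * (ε / (|α| + 1))| < ε := by
      rw [abs_mul, abs_of_pos hδ, ← mul_div_assoc, div_lt_iff₀ (by positivity)]
      nlinarith
    have h3 := (hwlow _ hδ).and ((h1.eventually (gt_mem_nhds h2)).and hwle)
    obtain ⟨N, hN⟩ := eventually_atTop.1 h3
    refine ⟨N, fun n hn => ?_⟩
    obtain ⟨a1, a2, a3⟩ := hN n hn.le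
    rw [Real.dist_eq, sub_zero, abs_of_nonneg (mul_nonneg (Real.sqrt_nonneg _) (by linarith))]
    exact a1.trans_lt a2
  have hw1 : Tendsto w atTop (nhds 1) := by
    have h := hw0.mul (tendsto_inv_atTop_zero.comp hk.sqrt_atTop)
    rw [zero_mul] at h
    have h' := (tendsto_const_nhds (x := (1 : ℝ))).sub h
    rw [sub_zero] at h'
    refine h'.congr' ?_
    filter_upwards [hk.sqrt_atTop.eventually_gt_atTop 0] with n hn
    simp only [Function.comp_apply]
    field_simp
    ring
  have key := (hw1.mul (tendsto_sqrt_mul_tail_ratio hF hk hA2 c)).sub hw0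
  rw [one_mul, sub_zero] at key
  refine key.congr' ?_
  filter_upwards [hk.eventually] with n hn
  have hk0 : (0 : ℝ) < k n := by exact_mod_cast hn.1
  have hs : 0 < Real.sqrt (k n) := Real.sqrt_pos.2 hk0
  have hss : (k n : ℝ) = Real.sqrt (k n) ^ 2 := (Real.sq_sqrt hk0.le).symm
  have hp := hF.tailDF_pos (quantileB ν ((n : ℝ) / k n))
  rw [hw]
  simp only
  generalize tailDF ν (Real.exp (-(c / Real.sqrt (k n))) * quantileB ν ((n : ℝ) / k n)) = T at *
  generalize tailDF ν (quantileB ν ((n : ℝ) / k n)) = B at *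
  generalize Real.sqrt (k n) = s at *
  rw [hss]
  field_simp
  ring

lemma abs_toReal_sub_toReal_le_one {E : Type*} [MeasurableSpace E] (μ ν : Measure E)
    [IsProbabilityMeasure μ] [IsProbabilityMeasure ν] (S : Set E) :
    |(μ S).toReal - (ν S).toReal| ≤ 1 := by
  have h1 : (μ S).toReal ≤ 1 := ENNReal.toReal_mono ENNReal.one_ne_top prob_le_one
  have h2 : (ν S).toReal ≤ 1 := ENNReal.toReal_mono ENNReal.one_ne_top prob_le_one
  have h3 : 0 ≤ (μ S).toReal := ENNReal.toReal_nonneg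
  have h4 : 0 ≤ (ν S).toReal := ENNReal.toReal_nonneg
  rw [abs_le]
  constructor <;> linarith

section Mixing

variable {Ω : Type*} [MeasureSpace Ω]

lemma IsStationary.map_shift {X : ℕ → Ω → ℝ} (hstat : IsStationary X)
    (hmeas : ∀ i, Measurable (X i)) {Φ : (ℕ → ℝ) → ℝ} (hΦ : Measurable Φ) (j j' : ℕ) :
    Measure.map (fun ω => Φ fun i => X (i + j) ω) (ℙ : Measure Ω) =
      Measure.map (fun ω => Φ fun i => X (i + j') ω) (ℙ : Measure Ω) := by
  have h (j : ℕ) : Measurable fun ω => fun i : ℕ => X (i + j) ω :=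
    measurable_pi_lambda _ fun i => hmeas _
  have key (j : ℕ) : Measure.map (fun ω => Φ fun i => X (i + j) ω) (ℙ : Measure Ω) =
      Measure.map Φ (Measure.map (fun ω => fun i : ℕ => X i ω) (ℙ : Measure Ω)) := by
    rw [← hstat j, Measure.map_map hΦ (h j)]
    rfl
  rw [key, key]

/-- Sum of `h (X i)` over the `p` indices following `j`. -/
def blockSum {Ω : Type*} (X : ℕ → Ω → ℝ) (h : ℝ → ℝ) (p j : ℕ) (ω : Ω) : ℝ :=
  ∑ i ∈ Finset.range p, h (X (i + 1 + j) ω)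

lemma measurable_blockSum {X : ℕ → Ω → ℝ} (hmeas : ∀ i, Measurable (X i)) {h : ℝ → ℝ}
    (hh : Measurable h) (p j : ℕ) : Measurable (blockSum X h p j) :=
  Finset.measurable_fun_sum _ fun _ _ => hh.comp (hmeas _)

lemma abs_blockSum_le {Ω : Type*} {X : ℕ → Ω → ℝ} {h : ℝ → ℝ} (hb : ∀ x, |h x| ≤ 1) (p j : ℕ) (ω : Ω) :
    |blockSum X h p j ω| ≤ p := by
  refine (Finset.abs_sum_le_sum_abs _ _).trans ?_
  refine (Finset.sum_le_sum fun i _ => hb _).trans ?_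
  simp

lemma map_blockSum {X : ℕ → Ω → ℝ} (hstat : IsStationary X) (hmeas : ∀ i, Measurable (X i))
    {h : ℝ → ℝ} (hh : Measurable h) (p j j' : ℕ) :
    Measure.map (blockSum X h p j) (ℙ : Measure Ω) =
      Measure.map (blockSum X h p j') (ℙ : Measure Ω) := by
  have hΦ : Measurable fun y : ℕ → ℝ => ∑ i ∈ Finset.range p, h (y i) :=
    Finset.measurable_fun_sum _ fun i _ => hh.comp (measurable_pi_apply i)
  have := hstat.map_shift hmeas hΦ (1 + j) (1 + j')
  simp only [← add_assoc] at this
  exact this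

variable [IsProbabilityMeasure (ℙ : Measure Ω)]

lemma le_betaMix {X : ℕ → Ω → ℝ} (hmeas : ∀ i, Measurable (X i)) (m lag : ℕ)
    {S : Set ((Fin m → ℝ) × (ℕ → ℝ))} (hS : MeasurableSet S) :
    |((Measure.map
        (fun ω => ((fun i : Fin m => X ((i : ℕ) + 1) ω, fun i : ℕ => X (m + lag + 1 + i) ω)))
        (ℙ : Measure Ω)) S).toReal
      - (((Measure.map (fun ω => fun i : Fin m => X ((i : ℕ) + 1) ω) (ℙ : Measure Ω)).prod
          (Measure.map (fun ω => fun i : ℕ => X (m + lag + 1 + i) ω) (ℙ : Measure Ω))) S).toReal|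
      ≤ betaMix X lag := by
  have h1 (m : ℕ) : Measurable fun ω => fun i : Fin m => X ((i : ℕ) + 1) ω :=
    measurable_pi_lambda _ fun i => hmeas _
  have h2 (m : ℕ) : Measurable fun ω => fun i : ℕ => X (m + lag + 1 + i) ω :=
    measurable_pi_lambda _ fun i => hmeas _
  have hb (m : ℕ) (S : Set ((Fin m → ℝ) × (ℕ → ℝ))) :
      |((Measure.map
          (fun ω => ((fun i : Fin m => X ((i : ℕ) + 1) ω, fun i : ℕ => X (m + lag + 1 + i) ω)))
          (ℙ : Measure Ω)) S).toReal
        - (((Measure.map (fun ω => fun i : Fin m => X ((i : ℕ) + 1) ω) (ℙ : Measure Ω)).prod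
            (Measure.map (fun ω => fun i : ℕ => X (m + lag + 1 + i) ω) (ℙ : Measure Ω))) S).toReal|
        ≤ 1 := by
    have := Measure.isProbabilityMeasure_map (μ := (ℙ : Measure Ω)) (h1 m).aemeasurable
    have := Measure.isProbabilityMeasure_map (μ := (ℙ : Measure Ω)) (h2 m).aemeasurable
    have := Measure.isProbabilityMeasure_map (μ := (ℙ : Measure Ω))
      ((h1 m).prodMk (h2 m)).aemeasurable
    exact abs_toReal_sub_toReal_le_one _ _ S
  have hne (m : ℕ) :
      Nonempty (Subtype (MeasurableSet : Set ((Fin m → ℝ) × (ℕ → ℝ)) → Prop)) :=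
    ⟨⟨∅, MeasurableSet.empty⟩⟩
  unfold betaMix
  refine le_trans ?_ (le_ciSup (ι := ℕ) ⟨1, ?_⟩ m)
  · exact le_ciSup
      (f := fun S : Subtype (MeasurableSet : Set ((Fin m → ℝ) × (ℕ → ℝ)) → Prop) =>
        |((Measure.map
          (fun ω => ((fun i : Fin m => X ((i : ℕ) + 1) ω, fun i : ℕ => X (m + lag + 1 + i) ω)))
          (ℙ : Measure Ω)) S.1).toReal
        - (((Measure.map (fun ω => fun i : Fin m => X ((i : ℕ) + 1) ω) (ℙ : Measure Ω)).prod
            (Measure.map (fun ω => fun i : ℕ => X (m + lag + 1 + i) ω)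
              (ℙ : Measure Ω))) S.1).toReal|)
      ⟨1, by rintro _ ⟨T, rfl⟩; exact hb m T.1⟩ ⟨S, hS⟩
  · rintro _ ⟨m', rfl⟩
    exact ciSup_le fun T => hb m' T.1

lemma betaMix_nonneg {X : ℕ → Ω → ℝ} (hmeas : ∀ i, Measurable (X i)) (lag : ℕ) :
    0 ≤ betaMix X lag :=
  (abs_nonneg _).trans (le_betaMix hmeas 0 lag MeasurableSet.empty)

/-- Decoupling of the past and of the future of a sequence separated by a gap. -/
lemma measure_pair_le_prod_add_betaMix {X : ℕ → Ω → ℝ} (hmeas : ∀ i, Measurable (X i))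
    (m lag : ℕ) {U V : Ω → ℝ} {f : (Fin m → ℝ) → ℝ} {g : (ℕ → ℝ) → ℝ}
    (hf : Measurable f) (hg : Measurable g)
    (hU : ∀ ω, U ω = f fun i => X ((i : ℕ) + 1) ω)
    (hV : ∀ ω, V ω = g fun i => X (m + lag + 1 + i) ω)
    {S : Set (ℝ × ℝ)} (hS : MeasurableSet S) :
    (ℙ : Measure Ω) {ω | (U ω, V ω) ∈ S} ≤
      ((Measure.map U (ℙ : Measure Ω)).prod (Measure.map V (ℙ : Measure Ω))) S
        + ENNReal.ofReal (betaMix X lag) := by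
  have h1 : Measurable fun ω => fun i : Fin m => X ((i : ℕ) + 1) ω :=
    measurable_pi_lambda _ fun i => hmeas _
  have h2 : Measurable fun ω => fun i : ℕ => X (m + lag + 1 + i) ω :=
    measurable_pi_lambda _ fun i => hmeas _
  have hfg : Measurable (Prod.map f g) := hf.prodMap hg
  have hle := le_betaMix hmeas m lag (hfg hS)
  have := Measure.isProbabilityMeasure_map (μ := (ℙ : Measure Ω)) h1.aemeasurable
  have := Measure.isProbabilityMeasure_map (μ := (ℙ : Measure Ω)) h2.aemeasurable
  have hprod : (Measure.map U (ℙ : Measure Ω)).prod (Measure.map V (ℙ : Measure Ω)) =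
      Measure.map (Prod.map f g)
        ((Measure.map (fun ω => fun i : Fin m => X ((i : ℕ) + 1) ω) (ℙ : Measure Ω)).prod
          (Measure.map (fun ω => fun i : ℕ => X (m + lag + 1 + i) ω) (ℙ : Measure Ω))) := by
    rw [← Measure.map_prod_map _ _ hf hg, Measure.map_map hf h1, Measure.map_map hg h2]
    congr 2
    · exact funext hU
    · exact funext hV
  rw [hprod, Measure.map_apply hfg hS]
  rw [Measure.map_apply (h1.prodMk h2) (hfg hS)] at hle
  have hset : {ω | (U ω, V ω) ∈ S} = (fun ω => ((fun i : Fin m => X ((i : ℕ) + 1) ω,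
      fun i : ℕ => X (m + lag + 1 + i) ω))) ⁻¹' (Prod.map f g ⁻¹' S) := by
    ext ω
    simp only [mem_ofPred_eq, mem_preimage, Prod.map, hU, hV]
  rw [hset, ← ENNReal.ofReal_toReal (measure_ne_top (ℙ : Measure Ω) _),
    ← ENNReal.ofReal_toReal (measure_ne_top (Measure.prod _ _) (Prod.map f g ⁻¹' S)),
    ← ENNReal.ofReal_add ENNReal.toReal_nonneg (betaMix_nonneg hmeas lag)]
  exact ENNReal.ofReal_le_ofReal (by linarith [(abs_le.1 hle).2])

lemma memLp_blockSum {X : ℕ → Ω → ℝ} (hmeas : ∀ i, Measurable (X i)) {h : ℝ → ℝ}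
    (hh : Measurable h) (hb : ∀ x, |h x| ≤ 1) (p j : ℕ) :
    MemLp (blockSum X h p j) 2 (ℙ : Measure Ω) :=
  MemLp.of_bound (measurable_blockSum hmeas hh p j).aestronglyMeasurable p
    (Eventually.of_forall fun ω => abs_blockSum_le hb p j ω)

/-- Up to mixing errors, the sum of `N` separated blocks is distributed as a sum of `N`
independent blocks. -/
lemma exists_law_sum_blocks {X : ℕ → Ω → ℝ} (hstat : IsStationary X)
    (hmeas : ∀ i, Measurable (X i)) {h : ℝ → ℝ} (hh : Measurable h) (hb : ∀ x, |h x| ≤ 1)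
    {p lag : ℕ} (hlag : lag ≤ p) (s N : ℕ) :
    ∃ τ : Measure ℝ, IsProbabilityMeasure τ ∧ MemLp id 2 τ ∧
      ∫ x, x ∂τ = N * ∫ ω, blockSum X h p 0 ω ∧
      Var[id; τ] = N * Var[blockSum X h p 0; (ℙ : Measure Ω)] ∧
      ∀ B : Set ℝ, MeasurableSet B →
        (ℙ : Measure Ω) {ω | ∑ j ∈ Finset.range N, blockSum X h p (p + s + 2 * p * j) ω ∈ B} ≤
          τ B + N * ENNReal.ofReal (betaMix X lag) := by
  set Y := blockSum X h p 0 with hY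
  have hYm : Measurable Y := measurable_blockSum hmeas hh p 0
  have hYL : MemLp Y 2 (ℙ : Measure Ω) := memLp_blockSum hmeas hh hb p 0
  set ν := Measure.map Y (ℙ : Measure Ω) with hν
  have hνp : IsProbabilityMeasure ν := Measure.isProbabilityMeasure_map hYm.aemeasurable
  have hνL : MemLp id 2 ν :=
    (memLp_map_measure_iff aestronglyMeasurable_id hYm.aemeasurable).2 hYL
  have hνi : ∫ x, x ∂ν = ∫ ω, Y ω := integral_map hYm.aemeasurable aestronglyMeasurable_id
  have hνv : Var[id; ν] = Var[Y; (ℙ : Measure Ω)] := variance_id_map hYm.aemeasurable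
  induction N with
  | zero =>
    refine ⟨Measure.dirac 0, inferInstance, ?_, by simp, by simp, fun B hB => ?_⟩
    · exact MemLp.of_bound aestronglyMeasurable_id 0
        (by rw [ae_dirac_eq]; simp)
    · simp only [Finset.range_zero, Finset.sum_empty, Nat.cast_zero, zero_mul, add_zero]
      rw [Measure.dirac_apply' _ hB]
      by_cases h0 : (0 : ℝ) ∈ B <;> simp [h0]
  | succ N ih =>
    obtain ⟨τ, hτ, hτL, hτi, hτv, hτB⟩ := ih
    have hadd : Measurable fun q : ℝ × ℝ => q.1 + q.2 := measurable_fst.add measurable_snd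
    have hL1 : MemLp (fun q : ℝ × ℝ => q.1) 2 (τ.prod ν) := hτL.comp_fst ν
    have hL2 : MemLp (fun q : ℝ × ℝ => q.2) 2 (τ.prod ν) := hνL.comp_snd τ
    refine ⟨Measure.map (fun q : ℝ × ℝ => q.1 + q.2) (τ.prod ν),
      Measure.isProbabilityMeasure_map hadd.aemeasurable, ?_, ?_, ?_, fun B hB => ?_⟩
    · exact (memLp_map_measure_iff aestronglyMeasurable_id hadd.aemeasurable).2 (hL1.add hL2)
    · rw [integral_map (f := fun x : ℝ => x) hadd.aemeasurable aestronglyMeasurable_id,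
        integral_add (hL1.integrable one_le_two) (hL2.integrable one_le_two),
        integral_fun_fst (fun x : ℝ => x), integral_fun_snd (fun x : ℝ => x)]
      simp only [probReal_univ, one_smul]
      rw [hτi, hνi]
      push_cast
      ring
    · rw [variance_id_map hadd.aemeasurable]
      have := variance_add_prod hτL hνL
      simp only [id] at this
      rw [this]
      change Var[id; τ] + Var[id; ν] = _
      rw [hτv, hνv]
      push_cast
      ring
    · set S := fun ω => ∑ j ∈ Finset.range N, blockSum X h p (p + s + 2 * p * j) ω with hS
      have hSm : Measurable S :=
        Finset.measurable_fun_sum _ fun _ _ => measurable_blockSum hmeas hh _ _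
      have := Measure.isProbabilityMeasure_map (μ := (ℙ : Measure Ω)) hSm.aemeasurable
      set m := 2 * p * N + s with hm
      have hU (ω : Ω) : S ω = (fun x : Fin m → ℝ => ∑ j ∈ Finset.range N, ∑ i ∈ Finset.range p,
          h (if hi : i + (p + s + 2 * p * j) < m then x ⟨i + (p + s + 2 * p * j), hi⟩ else 0))
          fun i => X ((i : ℕ) + 1) ω := by
        refine Finset.sum_congr rfl fun j hj => Finset.sum_congr rfl fun i hi => ?_
        have hlt : i + (p + s + 2 * p * j) < m := by
          have h1 := Finset.mem_range.1 hi
          have h2 : 2 * p * (j + 1) ≤ 2 * p * N :=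
            Nat.mul_le_mul_left _ (Finset.mem_range.1 hj)
          rw [Nat.mul_add] at h2
          omega
        simp only [hlt, dite_true]
        congr 2
        omega
      have hV (ω : Ω) : blockSum X h p (p + s + 2 * p * N) ω =
          (fun y : ℕ → ℝ => ∑ i ∈ Finset.range p, h (y (i + (p - lag))))
            fun i => X (m + lag + 1 + i) ω := by
        refine Finset.sum_congr rfl fun i _ => ?_
        congr 2
        omega
      have hfm : Measurable fun x : Fin m → ℝ =>
          ∑ j ∈ Finset.range N, ∑ i ∈ Finset.range p, h (if hi : i + (p + s + 2 * p * j) < m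
            then x ⟨i + (p + s + 2 * p * j), hi⟩ else 0) := by
        refine Finset.measurable_fun_sum _ fun j _ => Finset.measurable_fun_sum _ fun i _ =>
          hh.comp ?_
        by_cases hi : i + (p + s + 2 * p * j) < m
        · simp only [hi, dite_true]
          exact measurable_pi_apply _
        · simp only [hi, dite_false]
          exact measurable_const
      have hgm : Measurable fun y : ℕ → ℝ => ∑ i ∈ Finset.range p, h (y (i + (p - lag))) :=
        Finset.measurable_fun_sum _ fun i _ => hh.comp (measurable_pi_apply _)
      have hpre : MeasurableSet ((fun q : ℝ × ℝ => q.1 + q.2) ⁻¹' B) := hadd hB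
      have hmix := measure_pair_le_prod_add_betaMix hmeas m lag hfm hgm hU hV hpre
      rw [map_blockSum hstat hmeas hh p _ 0] at hmix
      have hset : {ω | ∑ j ∈ Finset.range (N + 1), blockSum X h p (p + s + 2 * p * j) ω ∈ B} =
          {ω | (S ω, blockSum X h p (p + s + 2 * p * N) ω) ∈
            (fun q : ℝ × ℝ => q.1 + q.2) ⁻¹' B} := by
        ext ω
        simp only [mem_ofPred_eq, mem_preimage, Finset.sum_range_succ, hS]
      rw [hset]
      refine hmix.trans ?_
      rw [Measure.map_apply hadd hB, Measure.prod_apply_symm hpre, Measure.prod_apply_symm hpre,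
        Nat.cast_add, Nat.cast_one, add_mul, one_mul, ← add_assoc]
      gcongr
      calc ∫⁻ y, Measure.map S ℙ ((fun x => (x, y)) ⁻¹' ((fun q : ℝ × ℝ => q.1 + q.2) ⁻¹' B)) ∂ν
          ≤ ∫⁻ y, (τ ((fun x => (x, y)) ⁻¹' ((fun q : ℝ × ℝ => q.1 + q.2) ⁻¹' B))
              + N * ENNReal.ofReal (betaMix X lag)) ∂ν := by
            refine lintegral_mono fun y => ?_
            have hmy : MeasurableSet
                ((fun x => (x, y)) ⁻¹' ((fun q : ℝ × ℝ => q.1 + q.2) ⁻¹' B)) :=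
              measurable_prodMk_right hpre
            rw [Measure.map_apply hSm hmy]
            exact hτB _ hmy
        _ = _ := by
            rw [lintegral_add_right _ measurable_const, lintegral_const, measure_univ, mul_one]

end Mixing

section Deviation

variable {Ω : Type*} [MeasureSpace Ω]

lemma blockSum_add {Ω : Type*} (X : ℕ → Ω → ℝ) (h : ℝ → ℝ) (a b j : ℕ) (ω : Ω) :
    blockSum X h (a + b) j ω = blockSum X h a j ω + blockSum X h b (j + a) ω := by
  unfold blockSum
  rw [Finset.sum_range_add]
  congr 1
  refine Finset.sum_congr rfl fun i _ => ?_
  congr 2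
  omega

lemma blockSum_eq_alternating {Ω : Type*} (X : ℕ → Ω → ℝ) (h : ℝ → ℝ) (p N : ℕ) (ω : Ω) :
    blockSum X h (p + 2 * p * N) 0 ω = blockSum X h p 0 ω
      + ∑ j ∈ Finset.range N, blockSum X h p (p + 0 + 2 * p * j) ω
      + ∑ j ∈ Finset.range N, blockSum X h p (p + p + 2 * p * j) ω := by
  induction N with
  | zero => simp
  | succ N ih =>
    have e : p + 2 * p * (N + 1) = p + 2 * p * N + (p + p) := by ring
    rw [e, blockSum_add, ih, blockSum_add, Finset.sum_range_succ, Finset.sum_range_succ]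
    have e1 : 0 + (p + 2 * p * N) = p + 0 + 2 * p * N := by ring
    have e2 : p + 0 + 2 * p * N + p = p + p + 2 * p * N := by ring
    rw [e1, e2]
    ring

lemma integral_comp_eq {X : ℕ → Ω → ℝ} (hstat : IsStationary X)
    (hmeas : ∀ i, Measurable (X i)) {h : ℝ → ℝ} (hh : Measurable h) (i : ℕ) :
    ∫ ω, h (X i ω) = ∫ ω, h (X 1 ω) := by
  have := hstat.map_shift hmeas (hh.comp (measurable_pi_apply 0)) i 1
  simp only [Function.comp, zero_add] at this
  have hm (i : ℕ) : Measurable fun ω => h (X i ω) := hh.comp (hmeas i)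
  rw [← integral_map (f := fun x : ℝ => x) (hm i).aemeasurable aestronglyMeasurable_id, this,
    integral_map (f := fun x : ℝ => x) (hm 1).aemeasurable aestronglyMeasurable_id]

variable [IsProbabilityMeasure (ℙ : Measure Ω)]

lemma integrable_comp {X : ℕ → Ω → ℝ} (hmeas : ∀ i, Measurable (X i)) {h : ℝ → ℝ}
    (hh : Measurable h) (hb : ∀ x, |h x| ≤ 1) (i : ℕ) :
    Integrable (fun ω => h (X i ω)) (ℙ : Measure Ω) :=
  Integrable.of_bound (hh.comp (hmeas i)).aestronglyMeasurable 1
    (Eventually.of_forall fun _ => hb _)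

lemma integral_blockSum {X : ℕ → Ω → ℝ} (hstat : IsStationary X)
    (hmeas : ∀ i, Measurable (X i)) {h : ℝ → ℝ} (hh : Measurable h) (hb : ∀ x, |h x| ≤ 1)
    (p j : ℕ) : ∫ ω, blockSum X h p j ω = p * ∫ ω, h (X 1 ω) := by
  unfold blockSum
  rw [integral_finsetSum _ fun i _ => integrable_comp hmeas hh hb _]
  simp [integral_comp_eq hstat hmeas hh]

lemma variance_blockSum_le {X : ℕ → Ω → ℝ} (hstat : IsStationary X)
    (hmeas : ∀ i, Measurable (X i)) {h : ℝ → ℝ} (hh : Measurable h) (hb : ∀ x, |h x| ≤ 1)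
    (p j : ℕ) :
    Var[blockSum X h p j; (ℙ : Measure Ω)] ≤ (p : ℝ) ^ 2 * ∫ ω, |h (X 1 ω)| := by
  have habs : ∀ x, |(fun x => |h x|) x| ≤ 1 := fun x => by simpa using hb x
  calc Var[blockSum X h p j; (ℙ : Measure Ω)] ≤ ∫ ω, blockSum X h p j ω ^ 2 := by
        exact variance_le_expectation_sq (measurable_blockSum hmeas hh p j).aestronglyMeasurable
    _ ≤ ∫ ω, p * blockSum X (fun x => |h x|) p j ω := by
        refine integral_mono (memLp_blockSum hmeas hh hb p j).integrable_sq
          (((memLp_blockSum hmeas hh.abs habs p j).integrable one_le_two).const_mul _)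
          fun ω => ?_
        have h1 := abs_blockSum_le hb (X := X) p j ω
        have h2 : |blockSum X h p j ω| ≤ blockSum X (fun x => |h x|) p j ω :=
          Finset.abs_sum_le_sum_abs _ _
        calc blockSum X h p j ω ^ 2 = |blockSum X h p j ω| * |blockSum X h p j ω| := by
              rw [← sq, sq_abs]
          _ ≤ _ := mul_le_mul h1 h2 (abs_nonneg _) (Nat.cast_nonneg _)
    _ = _ := by
        rw [integral_const_mul, integral_blockSum hstat hmeas hh.abs habs]
        ring

lemma measure_sum_blocks_deviation_le {X : ℕ → Ω → ℝ} (hstat : IsStationary X)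
    (hmeas : ∀ i, Measurable (X i)) {h : ℝ → ℝ} (hh : Measurable h) (hb : ∀ x, |h x| ≤ 1)
    {p lag : ℕ} (hlag : lag ≤ p) (s N : ℕ) {u : ℝ} (hu : 0 < u) :
    (ℙ : Measure Ω) {ω | u ≤ |∑ j ∈ Finset.range N, blockSum X h p (p + s + 2 * p * j) ω
        - N * ∫ ω, blockSum X h p 0 ω|} ≤
      ENNReal.ofReal (N * (Var[blockSum X h p 0; (ℙ : Measure Ω)] / u ^ 2 + betaMix X lag)) := by
  obtain ⟨τ, hτ, hτL, hτi, hτv, hτB⟩ := exists_law_sum_blocks hstat hmeas hh hb hlag s N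
  have hB : MeasurableSet {x : ℝ | u ≤ |x - N * ∫ ω, blockSum X h p 0 ω|} :=
    measurableSet_le measurable_const (measurable_id.sub_const _).abs
  refine (hτB _ hB).trans ?_
  have hcheb := meas_ge_le_variance_div_sq hτL hu
  simp only [id] at hcheb
  rw [hτi] at hcheb
  refine (add_le_add_left hcheb _).trans ?_
  change ENNReal.ofReal (Var[id; τ] / u ^ 2) + _ ≤ _
  rw [hτv, ← ENNReal.ofReal_natCast, ← ENNReal.ofReal_mul (Nat.cast_nonneg _),
    ← ENNReal.ofReal_add (div_nonneg (mul_nonneg (Nat.cast_nonneg _) (variance_nonneg _ _))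
      (sq_nonneg _)) (mul_nonneg (Nat.cast_nonneg _) (betaMix_nonneg hmeas lag))]
  exact ENNReal.ofReal_le_ofReal (le_of_eq (by ring))

/-- Deviation inequality for sums of a bounded function along a mixing sequence. -/
lemma measure_blockSum_deviation_le {X : ℕ → Ω → ℝ} (hstat : IsStationary X)
    (hmeas : ∀ i, Measurable (X i)) {h : ℝ → ℝ} (hh : Measurable h) (hb : ∀ x, |h x| ≤ 1)
    {p lag l : ℕ} (hp : 0 < p) (hlag : lag ≤ p) {u M : ℝ} (hu : 18 * (p : ℝ) ≤ u)
    (hM : (l : ℝ) ≤ 2 * p * M) :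
    (ℙ : Measure Ω) {ω | u ≤ |blockSum X h l 0 ω - l * ∫ ω, h (X 1 ω)|} ≤
      ENNReal.ofReal (2 * (M * (9 * Var[blockSum X h p 0; (ℙ : Measure Ω)] / u ^ 2
        + betaMix X lag))) := by
  have hp' : (0 : ℝ) < p := by exact_mod_cast hp
  have hu0 : 0 < u / 3 := by linarith
  set μ := ∫ ω, h (X 1 ω) with hμ
  have hμ1 : |μ| ≤ 1 := by
    have := norm_integral_le_of_norm_le_const (μ := (ℙ : Measure Ω)) (f := fun ω => h (X 1 ω))
      (C := 1) (Eventually.of_forall fun ω => hb _)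
    simpa using this
  obtain ⟨N, hN⟩ : ∃ N, N = (l - p) / (2 * p) := ⟨_, rfl⟩
  set D : ℕ → Ω → ℝ := fun s ω => ∑ j ∈ Finset.range N, blockSum X h p (p + s + 2 * p * j) ω
    - N * ∫ ω, blockSum X h p 0 ω with hD
  have hNl : 2 * p * N ≤ l := by
    have := Nat.mul_div_le (l - p) (2 * p)
    rw [← hN] at this
    omega
  have hNM : (N : ℝ) ≤ M := by
    have h1 : 2 * (p : ℝ) * N ≤ l := by exact_mod_cast hNl
    exact le_of_mul_le_mul_left (h1.trans hM) (by positivity)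
  have hrest (ω : Ω) : |blockSum X h l 0 ω - l * μ| ≤ |D 0 ω| + |D p ω| + 6 * p := by
    have hDeq : D 0 ω + D p ω = blockSum X h (p + 2 * p * N) 0 ω - blockSum X h p 0 ω
        - 2 * p * N * μ := by
      rw [blockSum_eq_alternating]
      simp only [hD, integral_blockSum hstat hmeas hh hb, ← hμ]
      ring
    have hDabs := abs_add_le (D 0 ω) (D p ω)
    rcases lt_or_ge l p with hlp | hlp
    · have h1 := abs_blockSum_le hb (X := X) l 0 ω
      have h2 : |(l : ℝ) * μ| ≤ l := by
        rw [abs_mul, Nat.abs_cast]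
        exact mul_le_of_le_one_right (Nat.cast_nonneg _) hμ1
      have h3 : (l : ℝ) ≤ p := by exact_mod_cast hlp.le
      have h4 := abs_sub (blockSum X h l 0 ω) (l * μ)
      linarith [abs_nonneg (D 0 ω), abs_nonneg (D p ω)]
    · have hL : p + 2 * p * N ≤ l := by
        have := Nat.mul_div_le (l - p) (2 * p)
        rw [← hN] at this
        omega
      have hL2 : l < p + 2 * p * N + 2 * p := by
        have := Nat.lt_mul_div_succ (l - p) (show 0 < 2 * p by omega)
        rw [← hN, Nat.mul_add] at this
        omega
      obtain ⟨q, rfl⟩ := Nat.exists_eq_add_of_le hL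
      have hq : (q : ℝ) ≤ 2 * p := by
        have : q ≤ 2 * p := by omega
        exact_mod_cast this
      have h1 := abs_blockSum_le hb (X := X) p 0 ω
      have h2 := abs_blockSum_le hb (X := X) q (0 + (p + 2 * p * N)) ω
      have h3 : blockSum X h (p + 2 * p * N + q) 0 ω - ((p + 2 * p * N + q : ℕ) : ℝ) * μ
          = D 0 ω + D p ω + (blockSum X h p 0 ω + blockSum X h q (0 + (p + 2 * p * N)) ω
            - (p + q) * μ) := by
        rw [hDeq, blockSum_add X h _ q]
        push_cast
        ring
      have h4 : |((p : ℝ) + q) * μ| ≤ p + q := by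
        rw [abs_mul, abs_of_nonneg (by positivity : (0 : ℝ) ≤ p + q)]
        exact mul_le_of_le_one_right (by positivity) hμ1
      rw [h3]
      have h5 := abs_add_le (D 0 ω + D p ω) (blockSum X h p 0 ω
        + blockSum X h q (0 + (p + 2 * p * N)) ω - (p + q) * μ)
      have h6 := abs_sub (blockSum X h p 0 ω + blockSum X h q (0 + (p + 2 * p * N)) ω)
        ((p + q) * μ)
      have h7 := abs_add_le (blockSum X h p 0 ω) (blockSum X h q (0 + (p + 2 * p * N)) ω)
      linarith
  have hbound (s : ℕ) : (ℙ : Measure Ω) {ω | u / 3 ≤ |D s ω|} ≤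
      ENNReal.ofReal (M * (9 * Var[blockSum X h p 0; (ℙ : Measure Ω)] / u ^ 2
        + betaMix X lag)) := by
    refine (measure_sum_blocks_deviation_le hstat hmeas hh hb hlag s N hu0).trans ?_
    refine ENNReal.ofReal_le_ofReal ?_
    have e : Var[blockSum X h p 0; (ℙ : Measure Ω)] / (u / 3) ^ 2 =
        9 * Var[blockSum X h p 0; (ℙ : Measure Ω)] / u ^ 2 := by
      field_simp
      ring
    rw [e]
    refine mul_le_mul_of_nonneg_right hNM (add_nonneg ?_ (betaMix_nonneg hmeas lag))
    exact div_nonneg (mul_nonneg (by norm_num) (variance_nonneg _ _)) (sq_nonneg _)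
  calc (ℙ : Measure Ω) {ω | u ≤ |blockSum X h l 0 ω - l * μ|}
      ≤ (ℙ : Measure Ω) ({ω | u / 3 ≤ |D 0 ω|} ∪ {ω | u / 3 ≤ |D p ω|}) := by
        refine measure_mono fun ω hω => ?_
        simp only [mem_union, mem_ofPred_eq] at hω ⊢
        by_contra! hcon
        linarith [hrest ω, hcon.1, hcon.2]
    _ ≤ _ := (measure_union_le _ _).trans (add_le_add (hbound 0) (hbound p))
    _ = _ := by
        rw [← two_mul, ENNReal.ofReal_mul zero_le_two]
        simp

end Deviation

/-- Length of the blocks used in the blocking argument. -/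
def blockLen (r : ℕ) : ℕ := max 1 ⌊(1 / 2 : ℝ) * r⌋₊

lemma blockLen_pos (r : ℕ) : 0 < blockLen r := lt_of_lt_of_le one_pos (le_max_left _ _)

lemma blockLen_le {r : ℕ} (hr : 0 < r) : blockLen r ≤ r := by
  refine max_le hr (Nat.floor_le_of_le ?_)
  have : (0 : ℝ) ≤ r := Nat.cast_nonneg _
  linarith

lemma div_four_le_blockLen (r : ℕ) : (r : ℝ) / 4 ≤ blockLen r := by
  have h1 : (1 : ℝ) ≤ blockLen r := by exact_mod_cast blockLen_pos r
  have h2 : (⌊(1 / 2 : ℝ) * r⌋₊ : ℝ) ≤ blockLen r := by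
    exact_mod_cast le_max_right 1 ⌊(1 / 2 : ℝ) * r⌋₊
  have h3 := Nat.lt_floor_add_one ((1 / 2 : ℝ) * r)
  linarith

lemma tendsto_blockLen_div_sqrt {Ω : Type*} [MeasureSpace Ω] {X : ℕ → Ω → ℝ} {k r : ℕ → ℕ}
    (hA1 : CondA1 X k r) :
    Tendsto (fun n => (blockLen (r n) : ℝ) / √(k n)) atTop (nhds 0) := by
  have h := hA1.2.2.sqrt
  rw [Real.sqrt_zero] at h
  refine squeeze_zero (fun n => by positivity) (fun n => ?_) h
  rw [Real.sqrt_div (sq_nonneg _), Real.sqrt_sq (Nat.cast_nonneg _)]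
  gcongr
  exact blockLen_le (hA1.1 n)

section

variable {Ω : Type*} [MeasureSpace Ω] [IsProbabilityMeasure (ℙ : Measure Ω)]

lemma tendsto_div_blockLen_mul_betaMix {X : ℕ → Ω → ℝ} (hmeas : ∀ i, Measurable (X i))
    {k r : ℕ → ℕ} (hA1 : CondA1 X k r) :
    Tendsto (fun n : ℕ => (n : ℝ) / blockLen (r n) * betaMix X ⌊(1 / 2 : ℝ) * r n⌋₊)
      atTop (nhds 0) := by
  have h := (hA1.2.1 (1 / 2) (by norm_num)).const_mul 4
  rw [mul_zero] at h
  refine squeeze_zero (fun n => mul_nonneg (by positivity) (betaMix_nonneg hmeas _))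
    (fun n => ?_) h
  rw [← mul_assoc]
  refine mul_le_mul_of_nonneg_right ?_ (betaMix_nonneg hmeas _)
  have h1 : (0 : ℝ) < r n := by exact_mod_cast hA1.1 n
  calc (n : ℝ) / blockLen (r n) ≤ n / (r n / 4) := by
        gcongr
        exact div_four_le_blockLen _
    _ = 4 * (n / r n) := by field_simp

/-- Deviation inequality at the scale `√k`. -/
lemma eventually_measure_deviation_le {X : ℕ → Ω → ℝ} (hstat : IsStationary X)
    (hmeas : ∀ i, Measurable (X i)) {k r : ℕ → ℕ} (hk : TailFraction k) (hA1 : CondA1 X k r)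
    {ε : ℝ} (hε : 0 < ε) :
    ∀ᶠ n : ℕ in atTop, ∀ (h : ℝ → ℝ) (l : ℕ), Measurable h → (∀ x, |h x| ≤ 1) → l ≤ n →
      (ℙ : Measure Ω) {ω | ε * √(k n) ≤ |blockSum X h l 0 ω - l * ∫ ω, h (X 1 ω)|} ≤
        ENNReal.ofReal (9 / ε ^ 2 * ((n : ℝ) / blockLen (r n) *
            Var[blockSum X h (blockLen (r n)) 0; (ℙ : Measure Ω)] / k n)
          + (n : ℝ) / blockLen (r n) * betaMix X ⌊(1 / 2 : ℝ) * r n⌋₊) := by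
  have h18 : (0 : ℝ) < ε / 18 := by positivity
  filter_upwards [hk.eventually, (tendsto_blockLen_div_sqrt hA1).eventually (gt_mem_nhds h18)]
    with n hn hn2 h l hh hb hl
  have hk0 : (0 : ℝ) < k n := by exact_mod_cast hn.1
  have hs : 0 < √(k n : ℝ) := Real.sqrt_pos.2 hk0
  have hp : (0 : ℝ) < blockLen (r n) := by exact_mod_cast blockLen_pos _
  refine (measure_blockSum_deviation_le hstat hmeas hh hb (blockLen_pos (r n))
    (le_max_right 1 ⌊(1 / 2 : ℝ) * r n⌋₊) (M := n / (2 * blockLen (r n))) ?_ ?_).trans ?_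
  · rw [div_lt_iff₀ hs] at hn2
    linarith
  · rw [mul_div_cancel₀ _ (by positivity)]
    exact_mod_cast hl
  · refine ENNReal.ofReal_le_ofReal (le_of_eq ?_)
    rw [mul_pow, Real.sq_sqrt hk0.le]
    field_simp

/-- Law of large numbers for small functions: if `n E|h_n(X₁)| = O(√k)`, the centered partial
sums are `o_P(√k)`. -/
lemma tendsto_measure_deviation {X : ℕ → Ω → ℝ} (hstat : IsStationary X)
    (hmeas : ∀ i, Measurable (X i)) {k r : ℕ → ℕ} (hk : TailFraction k) (hA1 : CondA1 X k r)
    {h : ℕ → ℝ → ℝ} (hh : ∀ n, Measurable (h n)) (hb : ∀ᶠ n in atTop, ∀ x, |h n x| ≤ 1)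
    {C : ℝ} (hC : ∀ᶠ n : ℕ in atTop, n * ∫ ω, |h n (X 1 ω)| ≤ C * √(k n))
    {l : ℕ → ℕ} (hl : ∀ n, l n ≤ n) {ε : ℝ} (hε : 0 < ε) :
    Tendsto (fun n => (ℙ : Measure Ω)
      {ω | ε * √(k n) ≤ |blockSum X (h n) (l n) 0 ω - l n * ∫ ω, h n (X 1 ω)|})
      atTop (nhds 0) := by
  have hlim : Tendsto (fun n : ℕ => 9 / ε ^ 2 * ((blockLen (r n) : ℝ) / √(k n) * C)
      + (n : ℝ) / blockLen (r n) * betaMix X ⌊(1 / 2 : ℝ) * r n⌋₊) atTop (nhds 0) := by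
    have := (((tendsto_blockLen_div_sqrt hA1).mul_const C).const_mul (9 / ε ^ 2)).add
      (tendsto_div_blockLen_mul_betaMix hmeas hA1)
    simpa using this
  have hlim' := ENNReal.tendsto_ofReal hlim
  rw [ENNReal.ofReal_zero] at hlim'
  refine tendsto_of_tendsto_of_tendsto_of_le_of_le' tendsto_const_nhds hlim'
    (Eventually.of_forall fun _ => zero_le) ?_
  filter_upwards [eventually_measure_deviation_le hstat hmeas hk hA1 hε, hb, hC, hk.eventually]
    with n hn hbn hCn hkn
  refine (hn (h n) (l n) (hh n) hbn (hl n)).trans (ENNReal.ofReal_le_ofReal ?_)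
  have hk0 : (0 : ℝ) < k n := by exact_mod_cast hkn.1
  have hs : 0 < √(k n : ℝ) := Real.sqrt_pos.2 hk0
  have hp : (0 : ℝ) < blockLen (r n) := by exact_mod_cast blockLen_pos _
  gcongr ?_ * ?_ + _
  rw [div_le_iff₀ hk0]
  calc (n : ℝ) / blockLen (r n) * Var[blockSum X (h n) (blockLen (r n)) 0; (ℙ : Measure Ω)]
      ≤ (n : ℝ) / blockLen (r n) * ((blockLen (r n) : ℝ) ^ 2 * ∫ ω, |h n (X 1 ω)|) := by
        gcongr
        exact variance_blockSum_le hstat hmeas (hh n) hbn _ _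
    _ = blockLen (r n) * (n * ∫ ω, |h n (X 1 ω)|) := by field_simp
    _ ≤ blockLen (r n) * (C * √(k n)) := by gcongr
    _ = blockLen (r n) / √(k n) * C * k n := by
        nth_rewrite 3 [← Real.mul_self_sqrt hk0.le]
        field_simp

lemma variance_sum_Icc_eq {Z : ℕ → Ω → ℝ} (hZ : ∀ i, MemLp (Z i) 2 (ℙ : Measure Ω)) (p : ℕ) :
    Var[fun ω => ∑ i ∈ Finset.Icc 1 p, Z i ω; (ℙ : Measure Ω)] =
      ∑ i ∈ Finset.Icc 1 p, Var[Z i; (ℙ : Measure Ω)]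
        + 2 * ∑ q ∈ pairsUpTo p, cov (Z q.1) (Z q.2) := by
  rw [variance_fun_sum' fun i _ => hZ i]
  have hsplit (i j : ℕ) : cov[Z i, Z j; (ℙ : Measure Ω)] =
      (if i = j then cov[Z i, Z j; (ℙ : Measure Ω)] else 0)
        + (if i < j then cov[Z i, Z j; (ℙ : Measure Ω)] else 0)
        + (if j < i then cov[Z j, Z i; (ℙ : Measure Ω)] else 0) := by
    rcases lt_trichotomy i j with hij | rfl | hij
    · simp [hij, hij.ne, hij.le.not_gt]
    · simp
    · simp [hij, hij.ne', hij.le.not_gt, covariance_comm (Z i) (Z j)]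
  rw [Finset.sum_congr rfl fun i _ => Finset.sum_congr rfl fun j _ => hsplit i j]
  simp only [Finset.sum_add_distrib]
  rw [Finset.sum_comm (f := fun i j => if j < i then cov[Z j, Z i; (ℙ : Measure Ω)] else 0)]
  have hpairs : ∑ q ∈ pairsUpTo p, cov (Z q.1) (Z q.2) =
      ∑ i ∈ Finset.Icc 1 p, ∑ j ∈ Finset.Icc 1 p,
        if i < j then cov[Z i, Z j; (ℙ : Measure Ω)] else 0 := by
    rw [pairsUpTo, Finset.sum_filter, Finset.sum_product]
    rfl
  have hdiag : ∑ i ∈ Finset.Icc 1 p, ∑ j ∈ Finset.Icc 1 p,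
      (if i = j then cov[Z i, Z j; (ℙ : Measure Ω)] else 0) =
      ∑ i ∈ Finset.Icc 1 p, Var[Z i; (ℙ : Measure Ω)] := by
    refine Finset.sum_congr rfl fun i hi => ?_
    rw [Finset.sum_ite_eq, if_pos hi, covariance_self (hZ i).aemeasurable]
  rw [hpairs, hdiag]
  ring

lemma blockSum_zero_eq {Ω : Type*} (X : ℕ → Ω → ℝ) (h : ℝ → ℝ) (p : ℕ) (ω : Ω) :
    blockSum X h p 0 ω = ∑ i ∈ Finset.Icc 1 p, h (X i ω) := by
  rw [blockSum, Finset.range_eq_Ico, Finset.sum_Ico_add' (fun i => h (X i ω)) 0 p 1]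
  rfl

lemma integral_indicator_lt_eq_tailDF {Ω : Type*} [MeasureSpace Ω] {X : Ω → ℝ} (hX : Measurable X) (x : ℝ) :
    ∫ ω, (if x < X ω then (1 : ℝ) else 0) = tailDF (Measure.map X (ℙ : Measure Ω)) x := by
  have h : (fun ω => if x < X ω then (1 : ℝ) else 0) =
      (X ⁻¹' Ioi x).indicator 1 := by
    ext ω
    simp [indicator]
  rw [h, integral_indicator_one (hX measurableSet_Ioi), tailDF, Measure.map_apply hX
    measurableSet_Ioi]
  rfl

/-- The covariance condition controls the fluctuations of the number of exceedances over the
deterministic threshold. -/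
lemma exists_exceedance_deviation_le {X : ℕ → Ω → ℝ} (hstat : IsStationary X)
    (hmeas : ∀ i, Measurable (X i)) {k r : ℕ → ℕ} (hk : TailFraction k) (hA1 : CondA1 X k r)
    {α χ ωc : ℝ}
    (hA3 : CondA3 X (quantileB (Measure.map (X 1) (ℙ : Measure Ω))) k r α χ ωc)
    {δ : ℝ} (hδ : 0 < δ) :
    ∃ C : ℝ, 0 < C ∧ ∀ᶠ n in atTop, (ℙ : Measure Ω)
      {ω | C * √(k n) ≤ |blockSum X (fun x =>
          if quantileB (Measure.map (X 1) (ℙ : Measure Ω)) (n / k n) < x then 1 else 0) n 0 ω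
        - n * tailDF (Measure.map (X 1) (ℙ : Measure Ω))
            (quantileB (Measure.map (X 1) (ℙ : Measure Ω)) (n / k n))|} ≤ ENNReal.ofReal δ := by
  set ν := Measure.map (X 1) (ℙ : Measure Ω) with hν
  have hνp : IsProbabilityMeasure ν := Measure.isProbabilityMeasure_map (hmeas 1).aemeasurable
  set C0 := 1 + (ωc + 1) with hC0
  have hC0pos : 0 < C0 := by have := hA3.2.1; positivity
  obtain ⟨C, hCpos, hC⟩ : ∃ C : ℝ, 0 < C ∧ 9 / C ^ 2 * C0 ≤ δ / 2 := by
    refine ⟨√(18 * C0 / δ), Real.sqrt_pos.2 (by positivity), ?_⟩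
    rw [Real.sq_sqrt (by positivity)]
    refine le_of_eq ?_
    field_simp
    norm_num
  refine ⟨C, hCpos, ?_⟩
  have hω := ((hA3.2.2 (1 / 2) (by norm_num) (by norm_num)).2).eventually
    (gt_mem_nhds (lt_add_one ωc))
  filter_upwards [eventually_measure_deviation_le hstat hmeas hk hA1 hCpos, hω, hk.eventually,
    (tendsto_div_blockLen_mul_betaMix hmeas hA1).eventually (gt_mem_nhds (half_pos hδ))]
    with n hn hωn hkn hβ
  set b := quantileB ν (n / k n) with hb
  have hk0 : (0 : ℝ) < k n := by exact_mod_cast hkn.1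
  have hn0 : (0 : ℝ) < n := by exact_mod_cast hkn.1.trans hkn.2.1
  have hp : (0 : ℝ) < blockLen (r n) := by exact_mod_cast blockLen_pos _
  have hhm : Measurable fun x : ℝ => if b < x then (1 : ℝ) else 0 :=
    Measurable.ite measurableSet_Ioi measurable_const measurable_const
  have hhb (x : ℝ) : |if b < x then (1 : ℝ) else 0| ≤ 1 := by split_ifs <;> simp
  have h0 := hn _ n hhm hhb le_rfl
  rw [integral_indicator_lt_eq_tailDF (hmeas 1)] at h0
  refine h0.trans (ENNReal.ofReal_le_ofReal ?_)
  set Z : ℕ → Ω → ℝ := fun i ω => if b < X i ω then (1 : ℝ) else 0 with hZ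
  have hZL (i : ℕ) : MemLp (Z i) 2 (ℙ : Measure Ω) :=
    MemLp.of_bound (hhm.comp (hmeas i)).aestronglyMeasurable 1
      (Eventually.of_forall fun ω => hhb _)
  have hVar : Var[blockSum X (fun x => if b < x then 1 else 0) (blockLen (r n)) 0;
      (ℙ : Measure Ω)] ≤ blockLen (r n) * (k n / n)
        + 2 * ∑ q ∈ pairsUpTo (blockLen (r n)), cov (Z q.1) (Z q.2) := by
    have : blockSum X (fun x => if b < x then 1 else 0) (blockLen (r n)) 0 =
        fun ω => ∑ i ∈ Finset.Icc 1 (blockLen (r n)), Z i ω := by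
      ext ω
      rw [blockSum_zero_eq]
    rw [this, variance_sum_Icc_eq hZL]
    refine add_le_add_left ?_ _
    have hvi (i : ℕ) : Var[Z i; (ℙ : Measure Ω)] ≤ k n / n := by
      refine (variance_le_expectation_sq (hZL i).aestronglyMeasurable).trans ?_
      have : (Z i) ^ 2 = Z i := by
        ext ω
        simp only [hZ, Pi.pow_apply]
        split_ifs <;> simp
      rw [this]
      refine (integral_comp_eq hstat hmeas hhm i).le.trans ?_
      rw [integral_indicator_lt_eq_tailDF (hmeas 1)]
      refine (tailDF_quantileB_le ν hkn.2.2).trans ?_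
      rw [inv_div]
    refine (Finset.sum_le_sum fun i _ => hvi i).trans ?_
    simp
  have hpairs : (n : ℝ) / blockLen (r n) *
      (2 * ∑ q ∈ pairsUpTo (blockLen (r n)), cov (Z q.1) (Z q.2)) / k n ≤ ωc + 1 := by
    rcases Nat.eq_zero_or_pos ⌊(1 / 2 : ℝ) * r n⌋₊ with h0 | h0
    · have : pairsUpTo (blockLen (r n)) = ∅ := by
        rw [blockLen, h0]
        rfl
      rw [this]
      simp only [Finset.sum_empty, mul_zero, zero_div]
      linarith [hA3.2.1]
    · have hpe : blockLen (r n) = ⌊(1 / 2 : ℝ) * r n⌋₊ := max_eq_right h0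
      rw [hpe]
      refine le_trans (le_of_eq ?_) hωn.le
      rw [hpe] at hp
      field_simp
      rfl
  have hmain : (n : ℝ) / blockLen (r n) *
      Var[blockSum X (fun x => if b < x then 1 else 0) (blockLen (r n)) 0; (ℙ : Measure Ω)]
        / k n ≤ C0 := by
    calc _ ≤ (n : ℝ) / blockLen (r n) * (blockLen (r n) * (k n / n)
          + 2 * ∑ q ∈ pairsUpTo (blockLen (r n)), cov (Z q.1) (Z q.2)) / k n := by gcongr
      _ = 1 + (n : ℝ) / blockLen (r n) *
          (2 * ∑ q ∈ pairsUpTo (blockLen (r n)), cov (Z q.1) (Z q.2)) / k n := by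
        field_simp
      _ ≤ C0 := by rw [hC0]; gcongr
  have h9 : (0 : ℝ) ≤ 9 / C ^ 2 := by positivity
  have := mul_le_mul_of_nonneg_left hmain h9
  linarith

end

/-- A monotone function that is close to a linear function on a fine grid is uniformly close
to it. -/
lemma abs_sub_le_of_grid {f : ℝ → ℝ} {a b s ε : ℝ} {J : ℕ} (hab : a < b) (hJ : 0 < J)
    (hf : MonotoneOn f (Icc a b)) (hs : 0 ≤ s) (hsJ : s * ((b - a) / J) ≤ ε / 2)
    (hgrid : ∀ j ∈ Finset.range (J + 1),
      |f (a + j * ((b - a) / J)) - s * (a + j * ((b - a) / J))| ≤ ε / 2)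
    {x : ℝ} (hx : x ∈ Icc a b) : |f x - s * x| ≤ ε := by
  have hJ' : (0 : ℝ) < J := by exact_mod_cast hJ
  set η := (b - a) / J with hη
  have hηpos : 0 < η := div_pos (sub_pos.2 hab) hJ'
  have hJη : J * η = b - a := mul_div_cancel₀ _ hJ'.ne'
  have hmem {j : ℕ} (hj : j ≤ J) : a + j * η ∈ Icc a b := by
    have h1 : (j : ℝ) ≤ J := by exact_mod_cast hj
    have h2 : (j : ℝ) * η ≤ J * η := by gcongr
    have h3 : 0 ≤ (j : ℝ) * η := by positivity
    constructor <;> linarith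
  obtain ⟨j, hj, hjx, hxj⟩ : ∃ j < J, a + j * η ≤ x ∧ x ≤ a + ((j + 1 : ℕ) : ℝ) * η := by
    rcases eq_or_lt_of_le hx.2 with rfl | hxb
    · refine ⟨J - 1, by omega, (hmem (by omega)).2, ?_⟩
      rw [Nat.sub_add_cancel hJ, hJη]
      linarith
    · have h0 : 0 ≤ (x - a) / η := div_nonneg (by linarith [hx.1]) hηpos.le
      refine ⟨⌊(x - a) / η⌋₊, ?_, ?_, ?_⟩
      · rw [Nat.floor_lt h0, div_lt_iff₀ hηpos]
        linarith
      · have := Nat.floor_le h0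
        rw [le_div_iff₀ hηpos] at this
        linarith
      · have := (Nat.lt_floor_add_one ((x - a) / η)).le
        rw [div_le_iff₀ hηpos] at this
        push_cast
        linarith
  have h1 := hf (hmem hj.le) hx hjx
  have h2 := hf hx (hmem hj) hxj
  have h3 := abs_le.1 (hgrid j (Finset.mem_range.2 (by omega)))
  have h4 := abs_le.1 (hgrid (j + 1) (Finset.mem_range.2 (by omega)))
  have h5 : s * (a + j * η) ≤ s * x := by gcongr
  have h6 : s * x ≤ s * (a + ((j + 1 : ℕ) : ℝ) * η) := by gcongr
  have h7 : s * (a + ((j + 1 : ℕ) : ℝ) * η) = s * (a + j * η) + s * η := by push_cast; ring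
  rw [abs_le]
  constructor <;> linarith [h3.1, h3.2, h4.1, h4.2]

/-- Pointwise convergence in probability of monotone processes to linear functions is uniform. -/
lemma tendsto_measure_exists_of_monotoneOn {Ω T : Type*} [MeasurableSpace Ω] (P : Measure Ω)
    {Z : ℕ → Ω → T → ℝ → ℝ} {s : T → ℝ} {s₀ a b : ℝ} (hab : a < b)
    (hs : ∀ t, 0 ≤ s t) (hs₀ : ∀ t, s t ≤ s₀)
    (hmono : ∀ n ω t, MonotoneOn (Z n ω t) (Icc a b))
    (hpt : ∀ x ∈ Icc a b, ∀ ε : ℝ, 0 < ε →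
      Tendsto (fun n => P {ω | ∃ t, ε < |Z n ω t x - s t * x|}) atTop (nhds 0))
    {ε : ℝ} (hε : 0 < ε) :
    Tendsto (fun n => P {ω | ∃ x ∈ Icc a b, ∃ t, ε < |Z n ω t x - s t * x|})
      atTop (nhds 0) := by
  obtain ⟨J, hJ⟩ := exists_nat_gt (max 0 (s₀ * (b - a) / (ε / 2)))
  have hJ0 : (0 : ℝ) < J := (le_max_left _ _).trans_lt hJ
  have hJpos : 0 < J := by exact_mod_cast hJ0
  have hJs : s₀ * ((b - a) / J) ≤ ε / 2 := by
    have := (le_max_right _ _).trans_lt hJ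
    rw [div_lt_iff₀ (by positivity)] at this
    rw [← mul_div_assoc, div_le_iff₀ hJ0]
    linarith
  have hη : 0 ≤ (b - a) / J := div_nonneg (sub_pos.2 hab).le hJ0.le
  have hmem (j : ℕ) (hj : j ∈ Finset.range (J + 1)) : a + j * ((b - a) / J) ∈ Icc a b := by
    have h1 : (j : ℝ) ≤ J := by exact_mod_cast Nat.lt_succ_iff.1 (Finset.mem_range.1 hj)
    have h2 : (j : ℝ) * ((b - a) / J) ≤ J * ((b - a) / J) := by gcongr
    have h3 : 0 ≤ (j : ℝ) * ((b - a) / J) := by positivity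
    rw [mul_div_cancel₀ _ hJ0.ne'] at h2
    constructor <;> linarith
  have hsum : Tendsto (fun n => ∑ j ∈ Finset.range (J + 1),
      P {ω | ∃ t, ε / 2 < |Z n ω t (a + j * ((b - a) / J)) - s t * (a + j * ((b - a) / J))|})
      atTop (nhds 0) := by
    have := tendsto_finsetSum (Finset.range (J + 1)) fun j hj =>
      hpt _ (hmem j hj) (ε / 2) (by positivity)
    simpa using this
  refine tendsto_of_tendsto_of_tendsto_of_le_of_le tendsto_const_nhds hsum
    (fun _ => zero_le) fun n => ?_
  refine (measure_mono fun ω hω => ?_).trans (measure_biUnion_finset_le _ _)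
  obtain ⟨x, hx, t, ht⟩ := hω
  by_contra hcon
  simp only [mem_iUnion, mem_ofPred_eq, not_exists, not_lt] at hcon
  refine ht.not_ge (abs_sub_le_of_grid hab hJpos (hmono n ω t) (hs t) ?_
    (fun j hj => hcon j hj t) hx)
  exact (mul_le_mul_of_nonneg_right (hs₀ t) hη).trans hJs

section

variable {Ω : Type*} [MeasureSpace Ω] [IsProbabilityMeasure (ℙ : Measure Ω)]

/-- Partial sums of monotone families of small functions with asymptotically linear mean are
uniformly close to their means. -/
lemma tendsto_measure_exists_blockSum_deviation {X : ℕ → Ω → ℝ} (hstat : IsStationary X)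
    (hmeas : ∀ i, Measurable (X i)) {k r : ℕ → ℕ} (hk : TailFraction k) (hA1 : CondA1 X k r)
    {d : ℕ → ℝ → ℝ → ℝ} (hdm : ∀ n c, Measurable (d n c))
    (hmono : ∀ n x, Monotone fun c => d n c x) (hd0 : ∀ n x, d n 0 x = 0)
    (hb : ∀ c, ∀ᶠ n in atTop, ∀ x, |d n c x| ≤ 1) {θ : ℝ} (hθ : 0 ≤ θ)
    (hmean : ∀ c, Tendsto (fun n : ℕ => n * (∫ ω, d n c (X 1 ω)) / √(k n)) atTop (nhds (θ * c)))
    {C ε : ℝ} (hC : 0 < C) (hε : 0 < ε) :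
    Tendsto (fun n : ℕ => (ℙ : Measure Ω) {ω | ∃ c ∈ Icc (-C) C, ∃ t : Icc (0 : ℝ) 1,
      ε < |blockSum X (d n c) ⌊n * (t : ℝ)⌋₊ 0 ω / √(k n) - t * θ * c|}) atTop (nhds 0) := by
  have hfix (c t : ℝ) (ht : t ∈ Icc (0 : ℝ) 1) (ε : ℝ) (hε : 0 < ε) :
      Tendsto (fun n : ℕ => (ℙ : Measure Ω)
        {ω | ε < |blockSum X (d n c) ⌊n * t⌋₊ 0 ω / √(k n) - t * θ * c|})
        atTop (nhds 0) := by
    have hsgn (n : ℕ) : ∫ ω, |d n c (X 1 ω)| = |∫ ω, d n c (X 1 ω)| := by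
      rcases le_total 0 c with hc | hc
      · have hnn (x : ℝ) : 0 ≤ d n c x := (hd0 n x).symm.le.trans (hmono n x hc)
        rw [abs_of_nonneg (integral_nonneg fun ω => hnn _)]
        exact integral_congr_ae (Eventually.of_forall fun ω => abs_of_nonneg (hnn _))
      · have hnp (x : ℝ) : d n c x ≤ 0 := (hmono n x hc).trans (hd0 n x).le
        rw [abs_of_nonpos (integral_nonpos fun ω => hnp _), ← integral_neg]
        exact integral_congr_ae (Eventually.of_forall fun ω => abs_of_nonpos (hnp _))
    have hl (n : ℕ) : ⌊(n : ℝ) * t⌋₊ ≤ n :=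
      Nat.floor_le_of_le (mul_le_of_le_one_right (Nat.cast_nonneg _) ht.2)
    have hbd : ∀ᶠ n : ℕ in atTop,
        n * ∫ ω, |d n c (X 1 ω)| ≤ (|θ * c| + 1) * √(k n) := by
      filter_upwards [(hmean c).abs.eventually (gt_mem_nhds (lt_add_one _)), hk.eventually]
        with n hn hkn
      have hs : 0 < √(k n : ℝ) := Real.sqrt_pos.2 (by exact_mod_cast hkn.1)
      rw [abs_div, abs_of_pos hs, div_lt_iff₀ hs, abs_mul, Nat.abs_cast] at hn
      rw [hsgn]
      exact hn.le
    have hdev := tendsto_measure_deviation hstat hmeas hk hA1 (fun n => hdm n c) (hb c) hbd hl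
      (half_pos hε)
    have hlim : Tendsto (fun n : ℕ => (⌊(n : ℝ) * t⌋₊ : ℝ) * (∫ ω, d n c (X 1 ω)) / √(k n))
        atTop (nhds (t * (θ * c))) := by
      have h1 : Tendsto (fun n : ℕ => (⌊t * (n : ℝ)⌋₊ : ℝ) / n) atTop (nhds t) :=
        (tendsto_nat_floor_mul_div_atTop ht.1).comp tendsto_natCast_atTop_atTop
      refine (h1.mul (hmean c)).congr' ?_
      filter_upwards [eventually_gt_atTop 0] with n hn
      have : (0 : ℝ) < n := by exact_mod_cast hn
      rw [mul_comm t]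
      field_simp
    have hlim' := (hlim.sub_const (t * (θ * c))).abs
    rw [sub_self, abs_zero] at hlim'
    refine tendsto_of_tendsto_of_tendsto_of_le_of_le' tendsto_const_nhds hdev
      (Eventually.of_forall fun _ => zero_le) ?_
    filter_upwards [hlim'.eventually (gt_mem_nhds (half_pos hε)), hk.eventually] with n hn hkn
    refine measure_mono fun ω hω => ?_
    have hs : 0 < √(k n : ℝ) := Real.sqrt_pos.2 (by exact_mod_cast hkn.1)
    simp only [mem_ofPred_eq] at hω ⊢
    set B := blockSum X (d n c) ⌊(n : ℝ) * t⌋₊ 0 ω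
    set m := (⌊(n : ℝ) * t⌋₊ : ℝ) * ∫ ω, d n c (X 1 ω)
    have h1 : |B - m| = |B / √(k n) - m / √(k n)| * √(k n) := by
      rw [← sub_div, abs_div, abs_of_pos hs, div_mul_cancel₀ _ hs.ne']
    rw [h1]
    refine mul_le_mul_of_nonneg_right ?_ hs.le
    have h2 := abs_sub_le (B / √(k n)) (m / √(k n)) (t * (θ * c))
    rw [← mul_assoc] at h2
    rw [← mul_assoc] at hn
    linarith
  have hblock_mono (h : ℝ → ℝ) (hh : ∀ x, 0 ≤ h x) (ω : Ω) (a b : ℕ) (hab : a ≤ b) :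
      blockSum X h a 0 ω ≤ blockSum X h b 0 ω :=
    Finset.sum_le_sum_of_subset_of_nonneg (Finset.range_mono hab) fun _ _ _ => hh _
  have hunif (c ε : ℝ) (hε : 0 < ε) : Tendsto (fun n : ℕ => (ℙ : Measure Ω)
      {ω | ∃ t : Icc (0 : ℝ) 1,
        ε < |blockSum X (d n c) ⌊n * (t : ℝ)⌋₊ 0 ω / √(k n) - t * θ * c|}) atTop (nhds 0) := by
    obtain ⟨σ, hσ, hσc, hσd⟩ : ∃ σ : ℝ, |σ| = 1 ∧ 0 ≤ σ * c ∧ ∀ n x, 0 ≤ σ * d n c x := by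
      rcases le_total 0 c with hc | hc
      · refine ⟨1, by simp, by simpa using hc, fun n x => ?_⟩
        rw [one_mul]
        exact (hd0 n x).symm.le.trans (hmono n x hc)
      · refine ⟨-1, by simp, by linarith, fun n x => ?_⟩
        linarith [(hmono n x hc).trans (hd0 n x).le]
    have habs (n : ℕ) (t : ℝ) (ω : Ω) :
        |σ * blockSum X (d n c) ⌊n * t⌋₊ 0 ω / √(k n) - θ * (σ * c) * t| =
          |blockSum X (d n c) ⌊n * t⌋₊ 0 ω / √(k n) - t * θ * c| := by
      rw [← one_mul |blockSum X (d n c) _ 0 ω / √(k n) - t * θ * c|, ← hσ, ← abs_mul]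
      congr 1
      ring
    have := tendsto_measure_exists_of_monotoneOn (ℙ : Measure Ω)
      (T := Unit) (Z := fun n ω _ t => σ * blockSum X (d n c) ⌊n * t⌋₊ 0 ω / √(k n))
      (s := fun _ => θ * (σ * c)) (s₀ := θ * (σ * c)) zero_lt_one
      (fun _ => mul_nonneg hθ hσc) (fun _ => le_rfl)
      (fun n ω _ t₁ _ t₂ _ h12 => by
        have h1 := hblock_mono (fun x => σ * d n c x) (hσd n) ω _ _
          (Nat.floor_mono (mul_le_mul_of_nonneg_left h12 (Nat.cast_nonneg n)))
        simp only [blockSum, ← Finset.mul_sum] at h1 ⊢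
        exact div_le_div_of_nonneg_right h1 (Real.sqrt_nonneg _))
      (fun t ht ε hε => by
        simpa only [habs, exists_const] using hfix c t ht ε hε) hε
    simpa only [habs, exists_const, Subtype.exists, exists_prop] using this
  have := tendsto_measure_exists_of_monotoneOn (ℙ : Measure Ω) (T := Icc (0 : ℝ) 1)
    (Z := fun n ω t c => blockSum X (d n c) ⌊n * (t : ℝ)⌋₊ 0 ω / √(k n))
    (s := fun t => t * θ) (s₀ := θ) (neg_lt_self hC)
    (fun t => mul_nonneg t.2.1 hθ) (fun t => mul_le_of_le_one_left hθ t.2.2)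
    (fun n ω t c₁ _ c₂ _ h12 => div_le_div_of_nonneg_right
      (Finset.sum_le_sum fun i _ => hmono n _ h12) (Real.sqrt_nonneg _))
    (fun c _ ε hε => hunif c ε hε) hε
  exact this

end

lemma monotone_phi1 : Monotone phi1 := fun x y h => by
  unfold phi1
  split_ifs <;> linarith

lemma monotone_phi2 : Monotone phi2 := fun _ _ h => max_le_max_right 0 h

/-- Increment of `φ` caused by a perturbation of the logarithm of the threshold `b`. -/
def shiftIncrement (φ : ℝ → ℝ) (b : ℝ) (k : ℕ) (c x : ℝ) : ℝ :=
  φ (Real.log x - Real.log b + c / √k) - φ (Real.log x - Real.log b)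

lemma measurable_shiftIncrement {φ : ℝ → ℝ} (hφ : Monotone φ) (b : ℝ) (k : ℕ) (c : ℝ) :
    Measurable (shiftIncrement φ b k c) :=
  (hφ.measurable.comp ((Real.measurable_log.sub_const _).add_const _)).sub
    (hφ.measurable.comp (Real.measurable_log.sub_const _))

lemma monotone_shiftIncrement {φ : ℝ → ℝ} (hφ : Monotone φ) (b : ℝ) (k : ℕ) (x : ℝ) :
    Monotone fun c => shiftIncrement φ b k c x := fun c₁ c₂ h => by
  have : c₁ / √(k : ℝ) ≤ c₂ / √(k : ℝ) := div_le_div_of_nonneg_right h (Real.sqrt_nonneg _)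
  have := hφ (add_le_add_right this (Real.log x - Real.log b))
  simp only [shiftIncrement]
  linarith

lemma shiftIncrement_zero (φ : ℝ → ℝ) (b : ℝ) (k : ℕ) (x : ℝ) :
    shiftIncrement φ b k 0 x = 0 := by
  simp [shiftIncrement]

lemma phi1_log_sub_add {x b u : ℝ} (hx : 0 ≤ x) (hb : 0 < b) (hu : u < Real.log b) :
    phi1 (Real.log x - Real.log b + u) = if Real.exp (-u) * b < x then 1 else 0 := by
  have h1 : Real.exp (-u) * b = Real.exp (Real.log b - u) := by
    rw [sub_eq_add_neg, add_comm, Real.exp_add, Real.exp_log hb]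
  have h2 : 0 < Real.log x - Real.log b + u ↔ Real.exp (-u) * b < x := by
    rw [h1]
    rcases hx.eq_or_lt with rfl | hx
    · rw [Real.log_zero]
      refine iff_of_false (by linarith) (Real.exp_pos _).not_gt
    · rw [← Real.lt_log_iff_exp_lt hx]
      constructor <;> intro <;> linarith
  rw [phi1]
  simp only [h2]

lemma abs_shiftIncrement_phi1_le (b : ℝ) (k : ℕ) (c x : ℝ) :
    |shiftIncrement phi1 b k c x| ≤ 1 := by
  unfold shiftIncrement phi1
  split_ifs <;> simp

lemma shiftIncrement_phi2_bounds (b : ℝ) (k : ℕ) (c x : ℝ) :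
    c / √k * phi1 (Real.log x - Real.log b) ≤ shiftIncrement phi2 b k c x ∧
      shiftIncrement phi2 b k c x ≤ c / √k * phi1 (Real.log x - Real.log b + c / √k) := by
  unfold shiftIncrement phi2 phi1
  generalize c / √(k : ℝ) = u
  generalize Real.log x - Real.log b = y
  constructor <;> split_ifs with h <;> rcases max_cases y 0 with ⟨h1, h2⟩ | ⟨h1, h2⟩ <;>
    rcases max_cases (y + u) 0 with ⟨h3, h4⟩ | ⟨h3, h4⟩ <;> linarith

lemma abs_shiftIncrement_phi2_le (b : ℝ) (k : ℕ) (c x : ℝ) :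
    |shiftIncrement phi2 b k c x| ≤ |c / √k| := by
  unfold shiftIncrement phi2
  refine (abs_max_sub_max_le_abs _ _ _).trans (le_of_eq ?_)
  rw [add_sub_cancel_left]

section

variable {Ω : Type*} [MeasureSpace Ω] [IsProbabilityMeasure (ℙ : Measure Ω)]

lemma eventually_quantileB_large {ν : Measure ℝ} [IsProbabilityMeasure ν] {α : ℝ}
    {l : ℝ → ℝ} (hF : ParetoTail ν α l) {k : ℕ → ℕ} (hk : TailFraction k) (c : ℝ) :
    ∀ᶠ n : ℕ in atTop, 0 < quantileB ν (n / k n) ∧ 0 < Real.log (quantileB ν (n / k n)) ∧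
      c / √(k n) < Real.log (quantileB ν (n / k n)) := by
  have hb := tendsto_quantileB_atTop hF hk
  have hlog := Real.tendsto_log_atTop.comp hb
  filter_upwards [hb.eventually_gt_atTop 0, hlog.eventually_gt_atTop 1,
    (hk.sqrt_atTop.const_div_atTop c).eventually (gt_mem_nhds one_pos)] with n h1 h2 h3
  exact ⟨h1, one_pos.trans h2, h3.trans h2⟩

lemma integral_phi1_log_sub_add {Ω : Type*} [MeasureSpace Ω] {Y : Ω → ℝ}
    (hY : Measurable Y) (hpos : ∀ ω, 0 ≤ Y ω)
    {b u : ℝ} (hb : 0 < b) (hu : u < Real.log b) :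
    ∫ ω, phi1 (Real.log (Y ω) - Real.log b + u) =
      tailDF (Measure.map Y (ℙ : Measure Ω)) (Real.exp (-u) * b) := by
  rw [← integral_indicator_lt_eq_tailDF hY]
  exact integral_congr_ae (Eventually.of_forall fun ω => phi1_log_sub_add (hpos ω) hb hu)

lemma integrable_phi1_log {Y : Ω → ℝ} (hY : Measurable Y) (b u : ℝ) :
    Integrable (fun ω => phi1 (Real.log (Y ω) - Real.log b + u)) (ℙ : Measure Ω) := by
  refine Integrable.of_bound (monotone_phi1.measurable.comp
    (((Real.measurable_log.comp hY).sub_const _).add_const _)).aestronglyMeasurable 1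
    (Eventually.of_forall fun ω => ?_)
  unfold phi1
  split_ifs <;> simp

lemma tendsto_mean_shiftIncrement_phi1 {Y : Ω → ℝ} (hY : Measurable Y) (hpos : ∀ ω, 0 ≤ Y ω)
    {α : ℝ} {l g : ℝ → ℝ} {K γ A : ℝ} (hF : ParetoTail (Measure.map Y (ℙ : Measure Ω)) α l)
    {k : ℕ → ℕ} (hk : TailFraction k)
    (hA2 : CondA2 l g K γ A (quantileB (Measure.map Y (ℙ : Measure Ω))) k) (c : ℝ) :
    Tendsto (fun n : ℕ => n * (∫ ω, shiftIncrement phi1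
        (quantileB (Measure.map Y (ℙ : Measure Ω)) (n / k n)) (k n) c (Y ω)) / √(k n))
      atTop (nhds (α * c)) := by
  have := Measure.isProbabilityMeasure_map (μ := (ℙ : Measure Ω)) hY.aemeasurable
  have h := (tendsto_exceedance_mean hF hk hA2 c).sub (tendsto_exceedance_mean hF hk hA2 0)
  rw [mul_zero, sub_zero] at h
  refine h.congr' ?_
  filter_upwards [eventually_quantileB_large hF hk c] with n hn
  have h0 := integral_phi1_log_sub_add hY hpos hn.1 hn.2.1
  have hc := integral_phi1_log_sub_add hY hpos hn.1 hn.2.2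
  have i0 := integrable_phi1_log hY (quantileB (Measure.map Y (ℙ : Measure Ω)) (n / k n)) 0
  simp only [add_zero] at h0 i0
  simp only [shiftIncrement]
  rw [integral_sub (integrable_phi1_log hY _ _) i0, h0, hc, zero_div]
  ring

lemma tendsto_mean_shiftIncrement_phi2 {Y : Ω → ℝ} (hY : Measurable Y) (hpos : ∀ ω, 0 ≤ Y ω)
    {α : ℝ} {l g : ℝ → ℝ} {K γ A : ℝ} (hF : ParetoTail (Measure.map Y (ℙ : Measure Ω)) α l)
    {k : ℕ → ℕ} (hk : TailFraction k)
    (hA2 : CondA2 l g K γ A (quantileB (Measure.map Y (ℙ : Measure Ω))) k) (c : ℝ) :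
    Tendsto (fun n : ℕ => n * (∫ ω, shiftIncrement phi2
        (quantileB (Measure.map Y (ℙ : Measure Ω)) (n / k n)) (k n) c (Y ω)) / √(k n))
      atTop (nhds (1 * c)) := by
  have := Measure.isProbabilityMeasure_map (μ := (ℙ : Measure Ω)) hY.aemeasurable
  have hratio (c' : ℝ) : Tendsto (fun n : ℕ => c * (n * tailDF (Measure.map Y (ℙ : Measure Ω))
      (Real.exp (-(c' / √(k n))) * quantileB (Measure.map Y (ℙ : Measure Ω)) (n / k n)) / k n))
      atTop (nhds (1 * c)) := by
    have h1 := ((tendsto_exceedance_mean hF hk hA2 c').div_atTop hk.sqrt_atTop).add_const 1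
    have h2 := h1.const_mul c
    rw [zero_add, mul_one] at h2
    rw [one_mul]
    refine h2.congr' ?_
    filter_upwards [hk.eventually] with n hn
    have hk0 : (0 : ℝ) < k n := by exact_mod_cast hn.1
    rw [div_div, Real.mul_self_sqrt hk0.le]
    field_simp
    ring
  refine tendsto_of_tendsto_of_tendsto_of_le_of_le' (hratio 0) (hratio c) ?_ ?_
  all_goals
    filter_upwards [eventually_quantileB_large hF hk c, hk.eventually] with n hn hkn
    set b := quantileB (Measure.map Y (ℙ : Measure Ω)) (n / k n)
    have hk0 : (0 : ℝ) < k n := by exact_mod_cast hkn.1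
    have hs : 0 < √(k n : ℝ) := Real.sqrt_pos.2 hk0
    have hint : Integrable (fun ω => shiftIncrement phi2 b (k n) c (Y ω)) (ℙ : Measure Ω) :=
      Integrable.of_bound
        ((measurable_shiftIncrement monotone_phi2 b (k n) c).comp hY).aestronglyMeasurable
        |c / √(k n)| (Eventually.of_forall fun ω => abs_shiftIncrement_phi2_le _ _ _ _)
    have hdiv (y : ℝ) : c * (n * y / k n) = n * (c / √(k n) * y) / √(k n) := by
      nth_rewrite 1 [← Real.mul_self_sqrt hk0.le]
      field_simp
    rw [hdiv]
    gcongr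
  · rw [zero_div, ← integral_phi1_log_sub_add hY hpos hn.1 hn.2.1, ← integral_const_mul]
    refine integral_mono ((integrable_phi1_log hY b 0).const_mul _) hint fun ω => ?_
    simp only [add_zero]
    exact (shiftIncrement_phi2_bounds b (k n) c (Y ω)).1
  · rw [← integral_phi1_log_sub_add hY hpos hn.1 hn.2.2, ← integral_const_mul]
    exact integral_mono hint ((integrable_phi1_log hY b _).const_mul _) fun ω =>
      (shiftIncrement_phi2_bounds b (k n) c (Y ω)).2

end

lemma orderStat_le {Ω : Type*} {n k : ℕ} (hkn : k ≤ n) {X : ℕ → Ω → ℝ} {ω : Ω}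
    (hpos : ∀ i, 0 ≤ X i ω) {x : ℝ}
    (hx : ((Finset.Icc 1 n).filter fun i => x < X i ω).card < k) : orderStat n k X ω ≤ x := by
  refine csInf_le ⟨0, fun y hy => ?_⟩ hx
  by_contra! hneg
  have : (Finset.Icc 1 n).filter (fun i => y < X i ω) = Finset.Icc 1 n :=
    Finset.filter_true_of_mem fun i _ => hneg.trans_le (hpos i)
  rw [mem_ofPred_eq, this, Nat.card_Icc] at hy
  omega

lemma le_orderStat {Ω : Type*} {n k : ℕ} (hk : 0 < k) {X : ℕ → Ω → ℝ} {ω : Ω} {x : ℝ}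
    (hx : k ≤ ((Finset.Icc 1 n).filter fun i => x < X i ω).card) : x ≤ orderStat n k X ω := by
  refine le_csInf ?_ fun y hy => ?_
  · obtain ⟨M, hM⟩ := ((Finset.Icc 1 n).image fun i => X i ω).bddAbove
    refine ⟨M, ?_⟩
    have : (Finset.Icc 1 n).filter (fun i => M < X i ω) = ∅ :=
      Finset.filter_false_of_mem fun i hi =>
        (hM (Finset.mem_coe.2 (Finset.mem_image_of_mem _ hi))).not_gt
    rw [mem_ofPred_eq, this]
    exact hk
  · by_contra! hlt
    refine absurd hy (not_lt.2 (hx.trans (Finset.card_le_card ?_)))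
    exact Finset.monotone_filter_right _ fun i _ hi => hlt.trans hi

lemma abs_biSup_sub_biSup_le {S : Finset ℕ} {f g : ℕ → ℝ} (hf : ∀ l, 0 ≤ f l)
    (hg : ∀ l, 0 ≤ g l) {δ : ℝ} (hδ : 0 ≤ δ) (h : ∀ l ∈ S, |f l - g l| ≤ δ) :
    |(⨆ l ∈ S, f l) - ⨆ l ∈ S, g l| ≤ δ := by
  have hval (f : ℕ → ℝ) (l : ℕ) : ⨆ _ : l ∈ S, f l = if l ∈ S then f l else 0 := by
    by_cases hl : l ∈ S
    · simp [hl]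
    · simp [hl, Real.iSup_of_isEmpty]
  have hbdd {f : ℕ → ℝ} (hf : ∀ l, 0 ≤ f l) :
      BddAbove (range fun l => if l ∈ S then f l else 0) := by
    refine ⟨∑ l ∈ S, f l, ?_⟩
    rintro _ ⟨l, rfl⟩
    by_cases hl : l ∈ S
    · simp only [hl, if_true]
      exact Finset.single_le_sum (fun i _ => hf i) hl
    · simp only [hl, if_false]
      exact Finset.sum_nonneg fun i _ => hf i
  simp only [hval]
  rw [abs_sub_le_iff]
  constructor <;> rw [sub_le_iff_le_add] <;> refine ciSup_le fun l => ?_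
  · have h1 := le_ciSup (hbdd hg) l
    by_cases hl : l ∈ S <;> simp only [hl, if_true, if_false] at h1 ⊢
    · linarith [(abs_le.1 (h l hl)).2]
    · linarith
  · have h1 := le_ciSup (hbdd hf) l
    by_cases hl : l ∈ S <;> simp only [hl, if_true, if_false] at h1 ⊢
    · linarith [(abs_le.1 (h l hl)).1]
    · linarith

lemma abs_cusumAt_sub_le {n l : ℕ} (hl : l ∈ Finset.Icc 1 n) {Y Y' : ℕ → ℝ} {a δ : ℝ}
    (h : ∀ j ∈ Finset.Icc 1 n, |∑ i ∈ Finset.Icc 1 j, (Y i - Y' i) - (j : ℝ) / n * a| ≤ δ) :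
    |cusumAt n Y l - cusumAt n Y' l| ≤ 2 * δ := by
  obtain ⟨hl1, hln⟩ := Finset.mem_Icc.1 hl
  have hn0 : (0 : ℝ) < n := by
    have : 0 < n := by omega
    exact_mod_cast this
  have h1 := h l hl
  have h2 := h n (Finset.mem_Icc.2 ⟨hl1.trans hln, le_rfl⟩)
  rw [div_self hn0.ne', one_mul] at h2
  have hfrac : (l : ℝ) / n ≤ 1 := by
    rw [div_le_one hn0]
    exact_mod_cast hln
  have hfrac0 : 0 ≤ (l : ℝ) / n := by positivity
  refine (abs_abs_sub_abs_le_abs_sub _ _).trans ?_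
  set D : ℕ → ℝ := fun j => ∑ i ∈ Finset.Icc 1 j, (Y i - Y' i) with hD
  have e : ∑ i ∈ Finset.Icc 1 l, Y i - (l : ℝ) / n * ∑ i ∈ Finset.Icc 1 n, Y i
      - (∑ i ∈ Finset.Icc 1 l, Y' i - (l : ℝ) / n * ∑ i ∈ Finset.Icc 1 n, Y' i) =
      (D l - (l : ℝ) / n * a) - (l : ℝ) / n * (D n - a) := by
    simp only [hD, Finset.sum_sub_distrib]
    ring
  rw [e]
  have h3 : |(l : ℝ) / n * (D n - a)| ≤ δ := by
    rw [abs_mul, abs_of_nonneg hfrac0]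
    exact (mul_le_of_le_one_left (abs_nonneg _) hfrac).trans h2
  linarith [abs_sub (D l - (l : ℝ) / n * a) ((l : ℝ) / n * (D n - a))]

section

variable {Ω : Type*} [MeasureSpace Ω]

/-- Normalized logarithmic deviation of the random threshold from the deterministic one. -/
def thresholdError (X : ℕ → Ω → ℝ) (k : ℕ → ℕ) (n : ℕ) (ω : Ω) : ℝ :=
  √(k n) * (Real.log (quantileB (Measure.map (X 1) (ℙ : Measure Ω)) (n / k n))
    - Real.log (orderStat n (k n) X ω))

lemma abs_cusum_sub_cusumDet_le {X : ℕ → Ω → ℝ} {k : ℕ → ℕ} {φ : ℝ → ℝ} {θ δ : ℝ} {n : ℕ}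
    {ω : Ω} (hk : 0 < k n) (hδ : 0 ≤ δ)
    (h : ∀ t : Icc (0 : ℝ) 1,
      |blockSum X (shiftIncrement φ (quantileB (Measure.map (X 1) (ℙ : Measure Ω)) (n / k n))
        (k n) (thresholdError X k n ω)) ⌊n * (t : ℝ)⌋₊ 0 ω / √(k n)
          - t * θ * thresholdError X k n ω| ≤ δ) :
    |cusum n (k n) X φ ω
      - cusumDet n (k n) X φ (quantileB (Measure.map (X 1) (ℙ : Measure Ω))) ω| ≤ 2 * δ := by
  have hs : 0 < √(k n : ℝ) := Real.sqrt_pos.2 (by exact_mod_cast hk)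
  set b := quantileB (Measure.map (X 1) (ℙ : Measure Ω)) (n / k n) with hb
  set q := orderStat n (k n) X ω with hq
  set ζ := thresholdError X k n ω with hζ
  have hζs : ζ / √(k n) = Real.log b - Real.log q := by
    rw [hζ, thresholdError, mul_div_cancel_left₀ _ hs.ne']
  have hincr (x : ℝ) : shiftIncrement φ b (k n) ζ x =
      φ (Real.log x - Real.log q) - φ (Real.log x - Real.log b) := by
    rw [shiftIncrement, hζs]
    congr 2
    ring
  have hsum : ∀ j ∈ Finset.Icc 1 n,
      |∑ i ∈ Finset.Icc 1 j, (φ (Real.log (X i ω) - Real.log q)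
        - φ (Real.log (X i ω) - Real.log b)) - (j : ℝ) / n * (θ * ζ * √(k n))|
        ≤ δ * √(k n) := by
    intro j hj
    obtain ⟨hj1, hjn⟩ := Finset.mem_Icc.1 hj
    have hn0 : (0 : ℝ) < n := by
      have : 0 < n := by omega
      exact_mod_cast this
    have hjn' : (j : ℝ) / n ≤ 1 := by
      rw [div_le_one hn0]
      exact_mod_cast hjn
    have h1 := h ⟨(j : ℝ) / n, by positivity, hjn'⟩
    simp only [mul_div_cancel₀ _ hn0.ne', Nat.floor_natCast, blockSum_zero_eq, hincr] at h1
    have h2 := mul_le_mul_of_nonneg_right h1 hs.le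
    rw [← abs_of_pos hs, ← abs_mul, abs_of_pos hs, sub_mul, div_mul_cancel₀ _ hs.ne'] at h2
    rw [← mul_assoc, ← mul_assoc]
    exact h2
  have hsup : |(⨆ l ∈ Finset.Icc 1 n,
        cusumAt n (fun i => φ (Real.log (X i ω) - Real.log q)) l)
      - ⨆ l ∈ Finset.Icc 1 n,
        cusumAt n (fun i => φ (Real.log (X i ω) - Real.log b)) l| ≤ 2 * (δ * √(k n)) :=
    abs_biSup_sub_biSup_le (fun _ => abs_nonneg _) (fun _ => abs_nonneg _) (by positivity)
      fun l hl => abs_cusumAt_sub_le hl hsum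
  rw [cusum, cusumDet, ← mul_sub, abs_mul, abs_of_pos (inv_pos.2 hs), inv_mul_le_iff₀ hs]
  linarith

variable [IsProbabilityMeasure (ℙ : Measure Ω)]

/-- The normalized deviation of the random threshold is bounded in probability. -/
lemma exists_measure_thresholdError_le {X : ℕ → Ω → ℝ} (hstat : IsStationary X)
    (hmeas : ∀ i, Measurable (X i)) (hpos : ∀ i ω, 0 ≤ X i ω) {α : ℝ} (hα : 0 < α)
    {l : ℝ → ℝ} (hF : ParetoTail (Measure.map (X 1) (ℙ : Measure Ω)) α l)
    {k r : ℕ → ℕ} (hk : TailFraction k) (hA1 : CondA1 X k r) {g : ℝ → ℝ} {K γ A : ℝ}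
    (hA2 : CondA2 l g K γ A (quantileB (Measure.map (X 1) (ℙ : Measure Ω))) k) {χ ωc : ℝ}
    (hA3 : CondA3 X (quantileB (Measure.map (X 1) (ℙ : Measure Ω))) k r α χ ωc)
    {δ : ENNReal} (hδ : 0 < δ) :
    ∃ C : ℝ, 0 < C ∧ ∀ᶠ n in atTop,
      (ℙ : Measure Ω) {ω | thresholdError X k n ω ∉ Icc (-C) C} ≤ δ := by
  have hνp := Measure.isProbabilityMeasure_map (μ := (ℙ : Measure Ω)) (hmeas 1).aemeasurable
  obtain ⟨δ', hδ'0, hδ'⟩ := ENNReal.lt_iff_exists_nnreal_btwn.1 (ENNReal.half_pos hδ.ne')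
  have hδ'pos : (0 : ℝ) < δ' := by exact_mod_cast hδ'0
  obtain ⟨C₁, hC₁, hdev⟩ := exists_exceedance_deviation_le hstat hmeas hk hA1 hA3 hδ'pos
  set C := (C₁ + 3) / α with hC
  have hCpos : 0 < C := by positivity
  have hαC : α * C = C₁ + 3 := mul_div_cancel₀ _ hα.ne'
  refine ⟨C, hCpos, ?_⟩
  have hunif := tendsto_measure_exists_blockSum_deviation hstat hmeas hk hA1
    (d := fun n => shiftIncrement phi1
      (quantileB (Measure.map (X 1) (ℙ : Measure Ω)) (n / k n)) (k n))
    (fun n c => measurable_shiftIncrement monotone_phi1 _ _ _)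
    (fun n x => monotone_shiftIncrement monotone_phi1 _ _ _)
    (fun n x => shiftIncrement_zero _ _ _ _)
    (fun c => Eventually.of_forall fun n x => abs_shiftIncrement_phi1_le _ _ _ _) hα.le
    (tendsto_mean_shiftIncrement_phi1 (hmeas 1) (hpos 1) hF hk hA2) hCpos one_pos
  have hmean := (tendsto_exceedance_mean hF hk hA2 0).abs
  rw [mul_zero, abs_zero] at hmean
  filter_upwards [hdev, (ENNReal.tendsto_nhds_zero.1 hunif) (δ / 2) (ENNReal.half_pos hδ.ne'),
    hmean.eventually (gt_mem_nhds one_pos), hk.eventually, eventually_quantileB_large hF hk C,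
    eventually_quantileB_large hF hk (-C)] with n h1 h2 h3 hkn hbC hbC'
  set b := quantileB (Measure.map (X 1) (ℙ : Measure Ω)) (n / k n) with hb
  have hk0 : (0 : ℝ) < k n := by exact_mod_cast hkn.1
  have hs : 0 < √(k n : ℝ) := Real.sqrt_pos.2 hk0
  have hn0 : (0 : ℝ) < n := by exact_mod_cast hkn.1.trans hkn.2.1
  rw [zero_div, neg_zero, Real.exp_zero, one_mul, abs_div, abs_of_pos hs, div_lt_one hs] at h3
  have hδ2 : ENNReal.ofReal (δ' : ℝ) ≤ δ / 2 := by
    rw [ENNReal.ofReal_coe_nnreal]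
    exact hδ'.le
  calc (ℙ : Measure Ω) {ω | thresholdError X k n ω ∉ Icc (-C) C} ≤ _ :=
        measure_mono fun ω hω => ?_
    _ ≤ _ := (measure_union_le _ _).trans (add_le_add (h1.trans hδ2) h2)
    _ = δ := ENNReal.add_halves δ
  rw [mem_union, mem_ofPred_eq, mem_ofPred_eq]
  by_contra! hcon
  obtain ⟨hcon1, hcon2⟩ := hcon
  refine hω ?_
  have hcount (x : ℝ) : blockSum X (fun y => if x < y then 1 else 0) n 0 ω =
      (((Finset.Icc 1 n).filter fun i => x < X i ω).card : ℝ) := by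
    rw [blockSum_zero_eq, Finset.sum_boole]
  have hshift (c : ℝ) (hc : c / √(k n) < Real.log b) :
      blockSum X (shiftIncrement phi1 b (k n) c) n 0 ω =
        (((Finset.Icc 1 n).filter fun i => Real.exp (-(c / √(k n))) * b < X i ω).card : ℝ)
          - blockSum X (fun y => if b < y then 1 else 0) n 0 ω := by
    rw [← hcount]
    simp only [blockSum, ← Finset.sum_sub_distrib]
    refine Finset.sum_congr rfl fun i _ => ?_
    have e1 := phi1_log_sub_add (hpos (i + 1 + 0) ω) hbC.1 hc
    have e0 := phi1_log_sub_add (hpos (i + 1 + 0) ω) hbC.1 hbC.2.1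
    rw [add_zero, neg_zero, Real.exp_zero, one_mul] at e0
    rw [shiftIncrement, e1, e0]
  have hsum (c : ℝ) (hc : c ∈ Icc (-C) C) :
      |blockSum X (shiftIncrement phi1 b (k n) c) n 0 ω - α * c * √(k n)| ≤ √(k n) := by
    have := hcon2 c hc ⟨1, zero_le_one, le_rfl⟩
    simp only [mul_one, Nat.floor_natCast, one_mul] at this
    have h4 := mul_le_mul_of_nonneg_right this hs.le
    rw [← abs_of_pos hs, ← abs_mul, abs_of_pos hs, sub_mul, div_mul_cancel₀ _ hs.ne',
      one_mul] at h4
    exact h4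
  have hup := abs_le.1 (hsum C ⟨by linarith, le_rfl⟩)
  have hdown := abs_le.1 (hsum (-C) ⟨le_rfl, by linarith⟩)
  rw [hshift C hbC.2.2, hαC] at hup
  rw [hshift (-C) hbC'.2.2, mul_neg, hαC] at hdown
  have hc1 := abs_lt.1 hcon1
  have hm := abs_lt.1 h3
  have hlow : Real.exp (-(C / √(k n))) * b ≤ orderStat n (k n) X ω := by
    refine le_orderStat hkn.1 ?_
    have : (k n : ℝ) ≤
        ((Finset.Icc 1 n).filter fun i => Real.exp (-(C / √(k n))) * b < X i ω).card := by
      linarith [hup.1, hc1.1, hm.1]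
    exact_mod_cast this
  have hhigh : orderStat n (k n) X ω ≤ Real.exp (-(-C / √(k n))) * b := by
    refine orderStat_le hkn.2.1.le (fun i => hpos i ω) ?_
    have : (((Finset.Icc 1 n).filter fun i =>
        Real.exp (-(-C / √(k n))) * b < X i ω).card : ℝ) < k n := by
      linarith [hdown.2, hc1.2, hm.2]
    exact_mod_cast this
  have hlogeq (u : ℝ) : Real.log (Real.exp u * b) = u + Real.log b := by
    rw [Real.log_mul (Real.exp_pos _).ne' hbC.1.ne', Real.log_exp]
  have hq0 : 0 < orderStat n (k n) X ω := (mul_pos (Real.exp_pos _) hbC.1).trans_le hlow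
  have hl1 := Real.log_le_log (mul_pos (Real.exp_pos _) hbC.1) hlow
  have hl2 := Real.log_le_log hq0 hhigh
  rw [hlogeq] at hl1 hl2
  rw [neg_div, neg_neg] at hl2
  have hCs : √(k n : ℝ) * (C / √(k n)) = C := mul_div_cancel₀ _ hs.ne'
  rw [thresholdError, ← hb]
  constructor
  · have := mul_le_mul_of_nonneg_left
      (show -(C / √(k n)) ≤ Real.log b - Real.log (orderStat n (k n) X ω) by linarith) hs.le
    rw [mul_neg, hCs] at this
    exact this
  · have := mul_le_mul_of_nonneg_left
      (show Real.log b - Real.log (orderStat n (k n) X ω) ≤ C / √(k n) by linarith) hs.le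
    rw [hCs] at this
    exact this

/-- Replacing the random threshold by the deterministic one is asymptotically negligible for
every monotone `φ` whose shift increments have an asymptotically linear mean. -/
lemma tendstoInMeasure_cusum_sub_cusumDet {X : ℕ → Ω → ℝ} (hstat : IsStationary X)
    (hmeas : ∀ i, Measurable (X i)) (hpos : ∀ i ω, 0 ≤ X i ω) {α : ℝ} (hα : 0 < α)
    {l : ℝ → ℝ} (hF : ParetoTail (Measure.map (X 1) (ℙ : Measure Ω)) α l)
    {k r : ℕ → ℕ} (hk : TailFraction k) (hA1 : CondA1 X k r) {g : ℝ → ℝ} {K γ A : ℝ}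
    (hA2 : CondA2 l g K γ A (quantileB (Measure.map (X 1) (ℙ : Measure Ω))) k) {χ ωc : ℝ}
    (hA3 : CondA3 X (quantileB (Measure.map (X 1) (ℙ : Measure Ω))) k r α χ ωc)
    {φ : ℝ → ℝ} (hφ : Monotone φ) {θ : ℝ} (hθ : 0 ≤ θ)
    (hb : ∀ c, ∀ᶠ n : ℕ in atTop, ∀ x, |shiftIncrement φ
      (quantileB (Measure.map (X 1) (ℙ : Measure Ω)) (n / k n)) (k n) c x| ≤ 1)
    (hmean : ∀ c, Tendsto (fun n : ℕ => n * (∫ ω, shiftIncrement φ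
        (quantileB (Measure.map (X 1) (ℙ : Measure Ω)) (n / k n)) (k n) c (X 1 ω)) / √(k n))
      atTop (nhds (θ * c))) :
    TendstoInMeasure (ℙ : Measure Ω) (fun n ω => cusum n (k n) X φ ω
      - cusumDet n (k n) X φ (quantileB (Measure.map (X 1) (ℙ : Measure Ω))) ω) atTop 0 := by
  rw [tendstoInMeasure_iff_norm]
  intro ε hε
  rw [ENNReal.tendsto_nhds_zero]
  intro δ hδ
  obtain ⟨C, hC, hζ⟩ := exists_measure_thresholdError_le hstat hmeas hpos hα hF hk hA1 hA2 hA3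
    (ENNReal.half_pos hδ.ne')
  have hunif := tendsto_measure_exists_blockSum_deviation hstat hmeas hk hA1
    (d := fun n => shiftIncrement φ
      (quantileB (Measure.map (X 1) (ℙ : Measure Ω)) (n / k n)) (k n))
    (fun n c => measurable_shiftIncrement hφ _ _ _)
    (fun n x => monotone_shiftIncrement hφ _ _ _)
    (fun n x => shiftIncrement_zero _ _ _ _) hb hθ hmean hC (ε := ε / 4) (by positivity)
  filter_upwards [hζ, (ENNReal.tendsto_nhds_zero.1 hunif) (δ / 2) (ENNReal.half_pos hδ.ne'),
    hk.eventually] with n h1 h2 hkn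
  calc _ ≤ _ := measure_mono fun ω hω => ?_
    _ ≤ _ := (measure_union_le _ _).trans (add_le_add h1 h2)
    _ = δ := ENNReal.add_halves δ
  rw [mem_union, mem_ofPred_eq, mem_ofPred_eq]
  by_contra! hcon
  have hle := abs_cusum_sub_cusumDet_le hkn.1 (by positivity)
    (fun t => hcon.2 _ hcon.1 t)
  rw [mem_ofPred_eq, Pi.zero_apply, sub_zero, Real.norm_eq_abs] at hω
  linarith

end

/-- Equations (4.24) and (4.25) of Kim–Lee (2009): replacing the random threshold `X_(k)`
by the deterministic quantile `b(n/k)` changes the cusum statistics only by `o_P(1)`. -/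
theorem cusum_threshold_replacement
    {Ω : Type*} [MeasureSpace Ω] [IsProbabilityMeasure (ℙ : Measure Ω)]
    (X : ℕ → Ω → ℝ) (hmeas : ∀ i, Measurable (X i)) (hpos : ∀ i ω, 0 ≤ X i ω)
    (hstat : IsStationary X)
    (α : ℝ) (hα : 0 < α) (l : ℝ → ℝ)
    (hF : ParetoTail (Measure.map (X 1) (ℙ : Measure Ω)) α l)
    (k r : ℕ → ℕ) (hk : TailFraction k)
    (hA1 : CondA1 X k r)
    (g : ℝ → ℝ) (K γ A : ℝ)
    (hA2 : CondA2 l g K γ A (quantileB (Measure.map (X 1) (ℙ : Measure Ω))) k)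
    (χ ωc : ℝ)
    (hA3 : CondA3 X (quantileB (Measure.map (X 1) (ℙ : Measure Ω))) k r α χ ωc) :
    (TendstoInMeasure (ℙ : Measure Ω)
      (fun n ω => cusum n (k n) X phi1 ω - cusumDet n (k n) X phi1 (quantileB (Measure.map (X 1) (ℙ : Measure Ω))) ω) atTop 0) ∧
    ((∀ ε : ℝ, 0 < ε →
      Tendsto (fun n : ℕ => max (k n : ℝ) ((r n : ℝ) ^ 3) *
          Real.exp (-(ε * Real.sqrt (k n) / r n))) atTop (nhds 0)) →
      TendstoInMeasure (ℙ : Measure Ω)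
        (fun n ω => cusum n (k n) X phi2 ω - cusumDet n (k n) X phi2 (quantileB (Measure.map (X 1) (ℙ : Measure Ω))) ω) atTop 0) := by
  refine ⟨tendstoInMeasure_cusum_sub_cusumDet hstat hmeas hpos hα hF hk hA1 hA2 hA3
    monotone_phi1 hα.le
    (fun c => Eventually.of_forall fun n x => abs_shiftIncrement_phi1_le _ _ _ _)
    (tendsto_mean_shiftIncrement_phi1 (hmeas 1) (hpos 1) hF hk hA2), fun _ =>
    tendstoInMeasure_cusum_sub_cusumDet hstat hmeas hpos hα hF hk hA1 hA2 hA3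
    monotone_phi2 zero_le_one (fun c => ?_)
    (tendsto_mean_shiftIncrement_phi2 (hmeas 1) (hpos 1) hF hk hA2)⟩
  have h : Tendsto (fun n : ℕ => |c / √(k n : ℝ)|) atTop (nhds |0|) :=
    (hk.sqrt_atTop.const_div_atTop c).abs
  rw [abs_zero] at h
  filter_upwards [h.eventually (gt_mem_nhds one_pos)] with n hn x
  exact (abs_shiftIncrement_phi2_le _ _ _ _).trans hn.le

end TailCusum
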